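/- arXiv:1208.2076 — 11 statements merged into one kernel-verified Lean document; each statement's English description precedes it below -/
import Mathlib

section
/- Let w ≥ 3 be an integer, let n be a positive integer with n ≥ w − 2, and let C be a code of length n over a finite alphabet Q with M codewords. If C is restricted (w,w)-separating, then M ≤ 2^{⌊(n−w+2)/2⌋} + w − 2. -/
/-- The feasible set of a set `U` of words: all words `x` such that whenever all
words of `U` take a common value on a coordinate, `x` also takes that value there. -/
def feasibleSet {Q : Type*} {n : ℕ} (U : Set (Fin n → Q)) : Set (Fin n → Q) :=
  {x | ∀ i : Fin n, ∀ c : Q, (∀ a ∈ U, a i = c) → x i = c}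

/-- A code `C` is restricted `(w1, w2)`-separating if the feasible sets of any two
disjoint nonempty subsets of `C` of sizes at most `w1` and `w2` are disjoint. -/
def RestrictedSeparating {Q : Type*} {n : ℕ} (C : Set (Fin n → Q)) (w1 w2 : ℕ) : Prop :=
  ∀ U V : Finset (Fin n → Q), ↑U ⊆ C → ↑V ⊆ C → U.Nonempty → V.Nonempty →
    Disjoint U V → U.card ≤ w1 → V.card ≤ w2 →
      Disjoint (feasibleSet (↑U : Set (Fin n → Q))) (feasibleSet (↑V : Set (Fin n → Q)))

/-- Any two disjoint nonempty subsets of `C` of size at most `w` take distinct constant values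
on some coordinate in `I`. -/
def SeparatingOn {ι Q : Type*} (C : Finset (ι → Q)) (I : Finset ι) (w : ℕ) : Prop :=
  ∀ U V : Finset (ι → Q), U ⊆ C → V ⊆ C → U.Nonempty → V.Nonempty → Disjoint U V →
    U.card ≤ w → V.card ≤ w →
      ∃ i ∈ I, ∃ p q, p ≠ q ∧ (∀ x ∈ U, x i = p) ∧ ∀ x ∈ V, x i = q

theorem RestrictedSeparating.separatingOn_univ {Q : Type*} {n w : ℕ} {C : Finset (Fin n → Q)}
    (hC : RestrictedSeparating (↑C : Set (Fin n → Q)) w w) :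
    SeparatingOn C Finset.univ w := by
  classical
  intro U V hU hV hUne hVne hd hUw hVw
  by_contra! hno
  obtain ⟨u, hu⟩ := hUne
  obtain ⟨v, hv⟩ := hVne
  let y : Fin n → Q := fun i => if ∀ x ∈ U, x i = u i then u i else v i
  refine Set.disjoint_left.1 (hC U V (by exact_mod_cast hU) (by exact_mod_cast hV) ⟨u, hu⟩
    ⟨v, hv⟩ hd hUw hVw) (?_ : y ∈ _) ?_
  · intro i p hp
    have h : ∀ x ∈ U, x i = u i := fun x hx => (hp x hx).trans (hp u hu).symm
    simp only [y, if_pos h]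
    exact hp u hu
  · intro i q hq
    by_cases h : ∀ x ∈ U, x i = u i
    · simp only [y, if_pos h]
      by_contra hne
      obtain ⟨x, hx, hxq⟩ := hno i (Finset.mem_univ i) (u i) q hne h
      exact hxq (hq x hx)
    · simp only [y, if_neg h]
      exact hq v hv

theorem SeparatingOn.erase {ι Q : Type*} [DecidableEq ι] [DecidableEq (ι → Q)]
    {C : Finset (ι → Q)} {I : Finset ι} {w : ℕ} (h : SeparatingOn C I (w + 1))
    {c : ι → Q} (hc : c ∈ C) (i : ι) : SeparatingOn (C.erase c) (I.erase i) w := by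
  intro U V hU hV hUne hVne hd hUw hVw
  have hcU : c ∉ U := fun hm => (Finset.mem_erase.1 (hU hm)).1 rfl
  have hcV : c ∉ V := fun hm => (Finset.mem_erase.1 (hV hm)).1 rfl
  have hUC := hU.trans (Finset.erase_subset c C)
  have hVC := hV.trans (Finset.erase_subset c C)
  obtain ⟨j, hj, p, q, hpq, hp, hq⟩ := h (insert c U) V (Finset.insert_subset hc hUC) hVC
    (Finset.insert_nonempty c U) hVne (Finset.disjoint_insert_left.2 ⟨hcV, hd⟩)
    ((Finset.card_insert_le c U).trans (by omega)) (by omega)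
  obtain ⟨k, hk, r, s, hrs, hr, hs⟩ := h U (insert c V) hUC (Finset.insert_subset hc hVC)
    hUne (Finset.insert_nonempty c V) (Finset.disjoint_insert_right.2 ⟨hcU, hd⟩)
    (by omega) ((Finset.card_insert_le c V).trans (by omega))
  by_cases hji : j = i
  · refine ⟨k, Finset.mem_erase.2 ⟨?_, hk⟩, r, s, hrs, hr,
      fun x hx => hs x (Finset.mem_insert_of_mem hx)⟩
    rintro rfl
    subst hji
    obtain ⟨v, hv⟩ := hVne
    apply hpq
    rw [← hp c (Finset.mem_insert_self c U), hs c (Finset.mem_insert_self c V),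
      ← hs v (Finset.mem_insert_of_mem hv), hq v hv]
  · exact ⟨j, Finset.mem_erase.2 ⟨hji, hj⟩, p, q, hpq,
      fun x hx => hp x (Finset.mem_insert_of_mem hx), hq⟩

/-- Codewords other than `b` are determined by where they agree with `a` among the coordinates
on which `a` and `b` agree and `c` differs from them. -/
theorem SeparatingOn.card_le_two_pow_add_one {ι Q : Type*} [DecidableEq Q]
    {C : Finset (ι → Q)} {I : Finset ι} (h : SeparatingOn C I 3) {a b c : ι → Q}
    (ha : a ∈ C) (hb : b ∈ C) (hc : c ∈ C) (hac : a ≠ c) (hbc : b ≠ c) :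
    C.card ≤ 2 ^ (I.filter fun i => a i = b i ∧ a i ≠ c i).card + 1 := by
  classical
  set J := I.filter fun i => a i = b i ∧ a i ≠ c i
  have key : ∀ x ∈ C, ∀ y ∈ C, y ≠ b → x ≠ y → x ≠ c → y ≠ a →
      J.filter (fun i => x i = a i) ≠ J.filter fun i => y i = a i := by
    intro x hx y hy hyb hxy hxc hya heq
    obtain ⟨i, hi, p, q, hpq, hp, hq⟩ := h {x, a, b} {y, c}
      (by simp [Finset.insert_subset_iff, *]) (by simp [Finset.insert_subset_iff, *])
      (by simp) (by simp) (by simp [hxy.symm, hya, hyb, hxc.symm, hac.symm, hbc.symm])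
      Finset.card_le_three (Finset.card_le_two.trans (by omega))
    simp only [Finset.mem_insert, Finset.mem_singleton, forall_eq_or_imp, forall_eq] at hp hq
    obtain ⟨hxp, hap, hbp⟩ := hp
    obtain ⟨hyq, hcq⟩ := hq
    have hmem : i ∈ J.filter fun i => x i = a i := by
      simp only [J, Finset.mem_filter]
      exact ⟨⟨hi, by rw [hap, hbp], by rwa [hap, hcq]⟩, by rw [hxp, hap]⟩
    rw [heq, Finset.mem_filter] at hmem
    exact hpq (by rw [← hap, ← hyq, hmem.2])
  have hcard : (C.erase b).card ≤ J.powerset.card := by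
    refine Finset.card_le_card_of_injOn (fun x => J.filter fun i => x i = a i)
      (fun x _ => Finset.mem_coe.2 (Finset.mem_powerset.2 (Finset.filter_subset _ J))) ?_
    intro x hx y hy heq
    obtain ⟨hxb, hxC⟩ := Finset.mem_erase.1 (Finset.mem_coe.1 hx)
    obtain ⟨hyb, hyC⟩ := Finset.mem_erase.1 (Finset.mem_coe.1 hy)
    by_contra hxy
    by_cases hxy' : x ≠ c ∧ y ≠ a
    · exact key x hxC y hyC hyb hxy hxy'.1 hxy'.2 heq
    · refine key y hyC x hxC hxb (Ne.symm hxy) ?_ ?_ heq.symm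
      · rintro rfl
        exact hxy' ⟨hxy, hac.symm⟩
      · rintro rfl
        exact hxy' ⟨hac, Ne.symm hxy⟩
  rw [Finset.card_powerset, Finset.card_erase_of_mem hb] at hcard
  omega

theorem SeparatingOn.card_le_of_three {ι Q : Type*} {C : Finset (ι → Q)} {I : Finset ι}
    (h : SeparatingOn C I 3) : C.card ≤ 2 ^ ((I.card - 1) / 2) + 1 := by
  classical
  by_cases hC : 2 < C.card
  swap
  · have := Nat.one_le_two_pow (n := (I.card - 1) / 2)
    omega
  obtain ⟨a, b, c, ha, hb, hc, hab, hac, hbc⟩ := Finset.two_lt_card_iff.1 hC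
  have hle : ∃ k, C.card ≤ 2 ^ k + 1 ∧ 3 * k ≤ I.card := by
    have h₁ := h.card_le_two_pow_add_one ha hb hc hac hbc
    have h₂ := h.card_le_two_pow_add_one hb hc ha hab.symm hac.symm
    have h₃ := h.card_le_two_pow_add_one hc ha hb hbc.symm hab
    set J₁ := I.filter fun i => a i = b i ∧ a i ≠ c i
    set J₂ := I.filter fun i => b i = c i ∧ b i ≠ a i
    set J₃ := I.filter fun i => c i = a i ∧ c i ≠ b i
    have hsum : J₁.card + J₂.card + J₃.card ≤ I.card := by
      rw [← Finset.card_union_of_disjoint, ← Finset.card_union_of_disjoint]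
      · exact Finset.card_le_card (by grind)
      · rw [Finset.disjoint_left]
        grind
      · rw [Finset.disjoint_left]
        grind
    by_cases h12 : 3 * J₁.card ≤ I.card
    · exact ⟨_, h₁, h12⟩
    by_cases h22 : 3 * J₂.card ≤ I.card
    · exact ⟨_, h₂, h22⟩
    exact ⟨_, h₃, by omega⟩
  obtain ⟨k, hk, hkI⟩ := hle
  have := Nat.pow_le_pow_right two_pos (show k ≤ (I.card - 1) / 2 by omega)
  omega

theorem SeparatingOn.card_le {ι Q : Type*} {w : ℕ} (hw : 3 ≤ w) :
    ∀ {C : Finset (ι → Q)} {I : Finset ι}, w - 2 ≤ I.card → SeparatingOn C I w →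
      C.card ≤ 2 ^ ((I.card + 2 - w) / 2) + w - 2 := by
  classical
  induction w, hw using Nat.le_induction with
  | base =>
    intro C I _ h
    have := h.card_le_of_three
    rw [show I.card + 2 - 3 = I.card - 1 by omega]
    omega
  | succ w hw ih =>
    intro C I hI h
    obtain rfl | ⟨c, hc⟩ := C.eq_empty_or_nonempty
    · simp
    obtain ⟨i, hi⟩ : I.Nonempty := Finset.card_pos.1 (by omega)
    have hIe := Finset.card_erase_of_mem hi
    have hle := ih (by omega) (h.erase hc i)
    rw [Finset.card_erase_of_mem hc, hIe,
      show I.card - 1 + 2 - w = I.card + 2 - (w + 1) by omega] at hle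
    have := Nat.one_le_two_pow (n := (I.card + 2 - (w + 1)) / 2)
    omega

/-- If `w ≥ 3`, `n ≥ w - 2` and `C` is a restricted `(w, w)`-separating code of
length `n` over a finite alphabet, then `|C| ≤ 2 ^ ⌊(n - w + 2) / 2⌋ + w - 2`. -/
theorem restricted_separating_upper_bound {Q : Type*} [Fintype Q] {n w : ℕ}
    (hw : 3 ≤ w) (hn : 0 < n) (hnw : w - 2 ≤ n) (C : Finset (Fin n → Q))
    (hC : RestrictedSeparating (↑C : Set (Fin n → Q)) w w) :
    C.card ≤ 2 ^ ((n + 2 - w) / 2) + w - 2 := by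
  simpa using hC.separatingOn_univ.card_le hw (by simpa using hnw)
end

section
/- Let 2 ≤ k ≤ q−1, let w1, w2 be positive integers with at least one of them greater than 1, and let f be a non-constant polynomial over F_q of degree less than k. Write Im f = {f(α^i) : 1 ≤ i ≤ q−1} (the image of f on the nonzero elements of F_q) and suppose 0 ∉ Im f. If there exist subsets E and F of Im f with 1 ≤ |E| ≤ w1, 1 ≤ |F| ≤ w2 and Im f = EF := {βγ : β ∈ E, γ ∈ F}, then the Reed–Solomon code RS_k(q) is not (w1,w2)-separating. -/
open scoped Pointwise

/-- The descendant set of a set `U` of words: all words `x` such that each coordinate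
of `x` agrees with some word of `U` there. -/
def descSet {Q : Type*} {n : ℕ} (U : Set (Fin n → Q)) : Set (Fin n → Q) :=
  {x | ∀ i : Fin n, ∃ a ∈ U, a i = x i}

/-- A code `C` is `(w1, w2)`-separating if the descendant sets of any two disjoint
nonempty subsets of `C` of sizes at most `w1` and `w2` are disjoint. -/
def Separating {Q : Type*} {n : ℕ} (C : Set (Fin n → Q)) (w1 w2 : ℕ) : Prop :=
  ∀ U V : Finset (Fin n → Q), ↑U ⊆ C → ↑V ⊆ C → U.Nonempty → V.Nonempty →
    Disjoint U V → U.card ≤ w1 → V.card ≤ w2 →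
      Disjoint (descSet (↑U : Set (Fin n → Q))) (descSet (↑V : Set (Fin n → Q)))

/-- The Reed–Solomon code of dimension `k` over the field `F` with primitive element `α`:
the words `(f(α^1), …, f(α^n))` for polynomials `f` of degree less than `k`. -/
def RSCode (F : Type*) [Field F] (n : ℕ) (α : F) (k : ℕ) : Set (Fin n → F) :=
  {c | ∃ f : Polynomial F, f.degree < (k : ℕ) ∧
    ∀ i : Fin n, c i = Polynomial.eval (α ^ ((i : ℕ) + 1)) f}

/-- If the powers of `α` exhaust the nonzero elements of a field with `q > 2` elements, then so do
the powers `α ^ (i + 1)` with `i < q - 1`. -/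
theorem exists_pow_succ_eq_of_exhaustive {F : Type*} [Field F] [Fintype F]
    (hq : 2 ≤ Fintype.card F - 1) {α : F} (hα : ∀ x : F, x ≠ 0 → ∃ m : ℕ, α ^ m = x)
    {x : F} (hx : x ≠ 0) : ∃ i : Fin (Fintype.card F - 1), α ^ ((i : ℕ) + 1) = x := by
  classical
  have hα0 : α ≠ 0 := by
    rintro rfl
    obtain ⟨y, hy⟩ : ∃ y, y ∉ ({0, 1} : Finset F) := by
      by_contra! h
      have h1 := Finset.card_le_card (fun y _ => h y : (Finset.univ : Finset F) ⊆ {0, 1})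
      have h2 : ({0, 1} : Finset F).card ≤ 2 := Finset.card_le_two
      rw [Finset.card_univ] at h1
      omega
    simp only [Finset.mem_insert, Finset.mem_singleton, not_or] at hy
    obtain ⟨m, hm⟩ := hα y hy.1
    rcases Nat.eq_zero_or_pos m with rfl | h
    · exact hy.2 (by simpa using hm.symm)
    · exact hy.1 (by rw [← hm, zero_pow h.ne'])
  have hα1 := FiniteField.pow_card_sub_one_eq_one α hα0
  obtain ⟨m, hm⟩ := hα (x * α⁻¹) (mul_ne_zero hx (inv_ne_zero hα0))
  refine ⟨⟨m % (Fintype.card F - 1), Nat.mod_lt _ (by omega)⟩, ?_⟩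
  rw [pow_succ, ← pow_eq_pow_mod m hα1, hm, inv_mul_cancel_right₀ hα0]

/-- If some non-constant polynomial `f` of degree `< k` has its image on `F_q^*`
expressible as a product set `E * F` with `|E| ≤ w1`, `|F| ≤ w2`, and `0 ∉ Im f`,
then `RS_k(q)` is not `(w1, w2)`-separating. -/
theorem RS_not_separating_of_image_mul {F : Type*} [Field F] [Fintype F] {q : ℕ}
    (hq : Fintype.card F = q) (α : F) (hα : ∀ x : F, x ≠ 0 → ∃ m : ℕ, α ^ m = x)
    {w1 w2 : ℕ} (hw1 : 1 ≤ w1) (hw2 : 1 ≤ w2) (hw : 1 < w1 ∨ 1 < w2)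
    {k : ℕ} (hk2 : 2 ≤ k) (hkq : k ≤ q - 1)
    (f : Polynomial F) (hfdeg : f.degree < (k : ℕ)) (hfnc : 0 < f.natDegree)
    (Imf : Set F)
    (hIm : Imf = {y | ∃ i : ℕ, 1 ≤ i ∧ i ≤ q - 1 ∧ y = Polynomial.eval (α ^ i) f})
    (h0 : (0 : F) ∉ Imf)
    (E Fs : Finset F) (hE : ↑E ⊆ Imf) (hFs : ↑Fs ⊆ Imf)
    (hEne : E.Nonempty) (hEcard : E.card ≤ w1)
    (hFne : Fs.Nonempty) (hFcard : Fs.card ≤ w2)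
    (hEF : Imf = (↑E : Set F) * (↑Fs : Set F)) :
    ¬ Separating (RSCode F (q - 1) α k) w1 w2 := by
  classical
  subst hq
  intro hsep
  have hne : ∀ g ∈ Fs, g ≠ 0 := fun g hg hg0 => h0 (hg0 ▸ hFs hg)
  have key := hsep (E.image fun e _ => e)
    (Fs.image fun g i => g⁻¹ * Polynomial.eval (α ^ ((i : ℕ) + 1)) f) ?_ ?_
    (hEne.image _) (hFne.image _) ?_
    (Finset.card_image_le.trans hEcard) (Finset.card_image_le.trans hFcard)
  · have hmem : ∀ i : Fin (Fintype.card F - 1),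
        ∃ e ∈ E, ∃ g ∈ Fs, e * g = Polynomial.eval (α ^ ((i : ℕ) + 1)) f := by
      intro i
      have h : Polynomial.eval (α ^ ((i : ℕ) + 1)) f ∈ Imf := by
        rw [hIm]
        exact ⟨i + 1, by omega, i.isLt, rfl⟩
      rw [hEF] at h
      simpa [Set.mem_mul] using h
    choose e he g hg heg using hmem
    refine Set.disjoint_left.mp key (show e ∈ _ from fun i => ?_) (show e ∈ _ from fun i => ?_)
    · exact ⟨fun _ => e i, Finset.mem_coe.mpr (Finset.mem_image_of_mem _ (he i)), rfl⟩
    · refine ⟨_, Finset.mem_coe.mpr (Finset.mem_image_of_mem _ (hg i)), ?_⟩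
      rw [← heg i, mul_comm (e i), inv_mul_cancel_left₀ (hne _ (hg i))]
  · intro c hc
    obtain ⟨e, -, rfl⟩ := Finset.mem_image.mp (Finset.mem_coe.mp hc)
    exact ⟨Polynomial.C e, Polynomial.degree_C_le.trans_lt (by exact_mod_cast (by omega : 0 < k)),
      by simp⟩
  · intro c hc
    obtain ⟨g, -, rfl⟩ := Finset.mem_image.mp (Finset.mem_coe.mp hc)
    refine ⟨g⁻¹ • f, (Polynomial.degree_smul_le _ _).trans_lt hfdeg, by simp⟩
  · rw [Finset.disjoint_left]
    rintro c hc hc'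
    obtain ⟨e, -, rfl⟩ := Finset.mem_image.mp hc
    obtain ⟨g, hg, hge⟩ := Finset.mem_image.mp hc'
    have hcard : (Finset.univ.erase (0 : F)).card = Fintype.card F - 1 := by
      rw [Finset.card_erase_of_mem (Finset.mem_univ _), Finset.card_univ]
    have hf : f = Polynomial.C (g * e) := by
      refine Polynomial.eq_of_degrees_lt_of_eval_finset_eq (Finset.univ.erase 0) ?_ ?_ ?_
      · exact hfdeg.trans_le (by rw [hcard]; exact_mod_cast hkq)
      · refine Polynomial.degree_C_le.trans_lt ?_
        rw [hcard]
        exact_mod_cast (by omega : 0 < Fintype.card F - 1)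
      · intro x hx
        obtain ⟨i, rfl⟩ :=
          exists_pow_succ_eq_of_exhaustive (hk2.trans hkq) hα (Finset.ne_of_mem_erase hx)
        have h : g⁻¹ * Polynomial.eval (α ^ ((i : ℕ) + 1)) f = e := congrFun hge i
        rw [Polynomial.eval_C, ← h, mul_inv_cancel_left₀ (hne g hg)]
    rw [hf, Polynomial.natDegree_C] at hfnc
    exact hfnc.false
end

section
/- Let 2 ≤ k ≤ q−1, let w1, w2 be positive integers with at least one of them greater than 1, and let f be a non-constant polynomial over F_q of degree less than k. Write Im f = {f(α^i) : 1 ≤ i ≤ q−1} (the image of f on the nonzero elements of F_q). If there exist subsets E and F of Im f with 1 ≤ |E| ≤ w1, 1 ≤ |F| ≤ w2 and Im f = E + F := {β + γ : β ∈ E, γ ∈ F}, then the Reed–Solomon code RS_k(q) is not (w1,w2)-separating. -/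
open scoped Pointwise

/-- If every nonzero element of a finite field with more than two elements is a power of `α`,
then every nonzero element is `α ^ (i + 1)` for some `i < q - 1`. -/
theorem exists_pow_succ_eq_of_forall_exists_pow {F : Type*} [Field F] [Fintype F]
    (hF : 2 < Fintype.card F) (α : F) (hα : ∀ x : F, x ≠ 0 → ∃ m : ℕ, α ^ m = x)
    {x : F} (hx : x ≠ 0) : ∃ i : Fin (Fintype.card F - 1), α ^ ((i : ℕ) + 1) = x := by
  classical
  have hα0 : α ≠ 0 := by
    rintro rfl
    have hsub : (Finset.univ : Finset F) ⊆ {0, 1} := by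
      intro y _
      by_cases hy : y = 0
      · simp [hy]
      · obtain ⟨m, rfl⟩ := hα y hy
        rcases m with _ | m <;> simp
    have hcard := (Finset.card_le_card hsub).trans Finset.card_le_two
    rw [Finset.card_univ] at hcard
    omega
  obtain ⟨m, hm⟩ := hα (x / α) (div_ne_zero hx hα0)
  refine ⟨⟨m % (Fintype.card F - 1), Nat.mod_lt _ (by omega)⟩, ?_⟩
  have hmod : α ^ (m % (Fintype.card F - 1)) = α ^ m := by
    conv_rhs => rw [← Nat.mod_add_div m (Fintype.card F - 1), pow_add, pow_mul,
      FiniteField.pow_card_sub_one_eq_one α hα0, one_pow, mul_one]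
  rw [pow_succ, hmod, hm, div_mul_cancel₀ _ hα0]

/-- A polynomial of degree less than `q - 1` that is constant on the nonzero elements of a
field with `q` elements is constant. -/
theorem Polynomial.eq_C_of_eval_eq_of_ne_zero {F : Type*} [Field F] [Fintype F]
    {f : Polynomial F} {c : F} (hf : f.natDegree < Fintype.card F - 1)
    (h : ∀ x : F, x ≠ 0 → f.eval x = c) : f = Polynomial.C c := by
  classical
  rw [← sub_eq_zero]
  refine Polynomial.eq_zero_of_natDegree_lt_card_of_eval_eq_zero' _
    (Finset.univ.erase (0 : F)) (fun x hx => ?_) ?_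
  · simp [h x (Finset.ne_of_mem_erase hx)]
  · rw [Polynomial.natDegree_sub_C, Finset.card_erase_of_mem (Finset.mem_univ _),
      Finset.card_univ]
    exact hf

/-- If some non-constant polynomial `f` of degree `< k` has its image on `F_q^*`
expressible as a sumset `E + F` with `|E| ≤ w1` and `|F| ≤ w2`, then `RS_k(q)` is
not `(w1, w2)`-separating. -/
theorem RS_not_separating_of_image_add {F : Type*} [Field F] [Fintype F] {q : ℕ}
    (hq : Fintype.card F = q) (α : F) (hα : ∀ x : F, x ≠ 0 → ∃ m : ℕ, α ^ m = x)
    {w1 w2 : ℕ} (hw1 : 1 ≤ w1) (hw2 : 1 ≤ w2) (hw : 1 < w1 ∨ 1 < w2)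
    {k : ℕ} (hk2 : 2 ≤ k) (hkq : k ≤ q - 1)
    (f : Polynomial F) (hfdeg : f.degree < (k : ℕ)) (hfnc : 0 < f.natDegree)
    (Imf : Set F)
    (hIm : Imf = {y | ∃ i : ℕ, 1 ≤ i ∧ i ≤ q - 1 ∧ y = Polynomial.eval (α ^ i) f})
    (E Fs : Finset F) (hE : ↑E ⊆ Imf) (hFs : ↑Fs ⊆ Imf)
    (hEne : E.Nonempty) (hEcard : E.card ≤ w1)
    (hFne : Fs.Nonempty) (hFcard : Fs.card ≤ w2)
    (hEF : Imf = (↑E : Set F) + (↑Fs : Set F)) :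
    ¬ Separating (RSCode F (q - 1) α k) w1 w2 := by
  classical
  subst hq
  have hnd : f.natDegree < k := (Polynomial.natDegree_lt_iff_degree_lt
    (Polynomial.ne_zero_of_natDegree_gt hfnc)).2 hfdeg
  have hCdeg (b : F) : (Polynomial.C b).degree < (k : ℕ) :=
    Polynomial.degree_C_le.trans_lt (by exact_mod_cast (by omega : 0 < k))
  let u : F → Fin (Fintype.card F - 1) → F := fun b _ => b
  let v : F → Fin (Fintype.card F - 1) → F := fun c i => f.eval (α ^ ((i : ℕ) + 1)) - c
  have huv (b c : F) : u b ≠ v c := by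
    intro h
    have hconst : f = Polynomial.C (b + c) := by
      refine Polynomial.eq_C_of_eval_eq_of_ne_zero (by omega) fun x hx => ?_
      obtain ⟨i, rfl⟩ := exists_pow_succ_eq_of_forall_exists_pow (by omega) α hα hx
      exact (eq_sub_iff_add_eq.1 (congrFun h i)).symm
    rw [hconst, Polynomial.natDegree_C] at hfnc
    exact hfnc.false
  have hdec (i : Fin (Fintype.card F - 1)) :
      ∃ b ∈ E, ∃ c ∈ Fs, b + c = f.eval (α ^ ((i : ℕ) + 1)) := by
    have hmem : f.eval (α ^ ((i : ℕ) + 1)) ∈ (↑E : Set F) + (↑Fs : Set F) := by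
      rw [← hEF, hIm]
      exact ⟨i + 1, by omega, by omega, rfl⟩
    simpa [Set.mem_add] using hmem
  choose b hb c hc hbc using hdec
  intro hsep
  have hdisj := hsep (E.image u) (Fs.image v) ?_ ?_ (hEne.image u) (hFne.image v) ?_
    (Finset.card_image_le.trans hEcard) (Finset.card_image_le.trans hFcard)
  · refine hdisj.notMem_of_mem_left (a := b) (fun i => ?_) (fun i => ?_)
    · exact ⟨u (b i), Finset.mem_coe.2 (Finset.mem_image_of_mem u (hb i)), rfl⟩
    · exact ⟨v (c i), Finset.mem_coe.2 (Finset.mem_image_of_mem v (hc i)),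
        sub_eq_iff_eq_add.2 (hbc i).symm⟩
  · intro w hw
    obtain ⟨b, -, rfl⟩ := Finset.mem_image.1 (Finset.mem_coe.1 hw)
    exact ⟨Polynomial.C b, hCdeg b, fun i => by simp [u]⟩
  · intro w hw
    obtain ⟨c, -, rfl⟩ := Finset.mem_image.1 (Finset.mem_coe.1 hw)
    exact ⟨f - Polynomial.C c,
      (Polynomial.degree_sub_le _ _).trans_lt (max_lt hfdeg (hCdeg c)),
      fun i => by simp [v]⟩
  · rw [Finset.disjoint_left]
    intro w hwu hwv
    obtain ⟨b, -, rfl⟩ := Finset.mem_image.1 hwu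
    obtain ⟨c, -, hcb⟩ := Finset.mem_image.1 hwv
    exact huv b c hcb.symm
end

section
/- Let w1, w2 be positive integers with at least one of them greater than 1, and let 2 ≤ k ≤ q−1 with (k−1) dividing (q−1). If the Reed–Solomon code RS_k(q) is (w1,w2)-separating, then k < (q−1)/(w1·w2) + 1, i.e., (k−1)·w1·w2 < q−1. -/
open scoped Pointwise

/-- A constant word belongs to every Reed–Solomon code of positive dimension. -/
theorem const_mem_RSCode {F : Type*} [Field F] (n : ℕ) (α : F) {k : ℕ} (hk : 0 < k) (a : F) :
    (fun _ => a) ∈ RSCode F n α k :=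
  ⟨Polynomial.C a, Polynomial.degree_C_le.trans_lt (by exact_mod_cast hk), fun i => by simp⟩

/-- The word of a monomial of degree less than `k` belongs to the Reed–Solomon code of
dimension `k`. -/
theorem monomial_mem_RSCode {F : Type*} [Field F] (n : ℕ) (α : F) {k d : ℕ} (hd : d < k) (a : F) :
    (fun i : Fin n => a * (α ^ ((i : ℕ) + 1)) ^ d) ∈ RSCode F n α k :=
  ⟨Polynomial.C a * Polynomial.X ^ d,
    (Polynomial.degree_C_mul_X_pow_le d a).trans_lt (by exact_mod_cast hd), fun i => by simp⟩

/-- If the powers of `α` exhaust the nonzero elements of a finite field `F`, then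
`α ^ d = 1` forces `|F| - 1` to divide `d`. -/
theorem card_sub_one_dvd_of_pow_eq_one {F : Type*} [Field F] [Fintype F] {α : F}
    (hα : ∀ x : F, x ≠ 0 → ∃ m : ℕ, α ^ m = x) {d : ℕ} (hd : α ^ d = 1) :
    Fintype.card F - 1 ∣ d := by
  rw [← FiniteField.forall_pow_eq_one_iff F d]
  intro x
  obtain ⟨m, hm⟩ := hα x x.ne_zero
  ext
  rw [Units.val_pow_eq_pow_val, ← hm, ← pow_mul, mul_comm, pow_mul, hd, one_pow, Units.val_one]

/-- If the powers of `α` exhaust the nonzero elements of a field with more than two elements,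
then `α` is nonzero. -/
theorem ne_zero_of_forall_exists_pow_eq {F : Type*} [Field F] [Fintype F] {α : F}
    (hα : ∀ x : F, x ≠ 0 → ∃ m : ℕ, α ^ m = x) (hF : 2 ≤ Fintype.card F - 1) : α ≠ 0 := by
  rintro rfl
  have h : Fintype.card F - 1 ∣ 1 := by
    rw [← FiniteField.forall_pow_eq_one_iff F 1]
    intro x
    obtain ⟨m, hm⟩ := hα x x.ne_zero
    rcases Nat.eq_zero_or_pos m with rfl | hpos
    · ext
      simp [← hm]
    · exact absurd (hm.symm.trans (zero_pow hpos.ne')) x.ne_zero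
  have := Nat.le_of_dvd one_pos h
  omega

/-- If `k - 1` divides `q - 1` and `RS_k(q)` is `(w1, w2)`-separating, then
`(k - 1) · w1 · w2 < q - 1`. -/
theorem RS_separating_dim_bound_of_dvd_sub_one {F : Type*} [Field F] [Fintype F] {q : ℕ}
    (hq : Fintype.card F = q) (α : F) (hα : ∀ x : F, x ≠ 0 → ∃ m : ℕ, α ^ m = x)
    {w1 w2 : ℕ} (hw1 : 1 ≤ w1) (hw2 : 1 ≤ w2) (hw : 1 < w1 ∨ 1 < w2)
    {k : ℕ} (hk2 : 2 ≤ k) (hkq : k ≤ q - 1) (hdvd : (k - 1) ∣ (q - 1))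
    (hsep : Separating (RSCode F (q - 1) α k) w1 w2) :
    (k - 1) * w1 * w2 < q - 1 := by
  classical
  subst hq
  by_contra! hle
  obtain ⟨m, hm⟩ := hdvd
  set n := Fintype.card F - 1 with hn
  set d := k - 1 with hd
  have hd0 : 0 < d := by omega
  have hm0 : 0 < m := Nat.pos_of_ne_zero (by rintro rfl; omega)
  have hmw : m ≤ w1 * w2 := by
    rw [hm, mul_assoc] at hle
    exact Nat.le_of_mul_le_mul_left hle hd0
  have hα0 : α ≠ 0 := ne_zero_of_forall_exists_pow_eq hα (by omega)
  have hαn : α ^ n = 1 := FiniteField.pow_card_sub_one_eq_one α hα0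
  have hαd : α ^ d ≠ 1 := fun h => by
    have := Nat.le_of_dvd hd0 (card_sub_one_dvd_of_pow_eq_one hα h)
    omega
  set γ := α ^ d with hγ
  have hγ0 : γ ≠ 0 := pow_ne_zero _ hα0
  have hγm : γ ^ m = 1 := by rw [hγ, ← pow_mul, ← hm, hαn]
  let u : ℕ → Fin n → F := fun r _ => γ ^ r
  let v : ℕ → Fin n → F := fun j i => (γ ^ (w1 * j))⁻¹ * (α ^ ((i : ℕ) + 1)) ^ d
  have huv (r j : ℕ) : u r ≠ v j := by
    intro h
    have h0 : γ ^ r = (γ ^ (w1 * j))⁻¹ * (α ^ (0 + 1)) ^ d := congrFun h ⟨0, by omega⟩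
    have h1 : γ ^ r = (γ ^ (w1 * j))⁻¹ * (α ^ (n - 1 + 1)) ^ d :=
      congrFun h ⟨n - 1, by omega⟩
    rw [h0, Nat.sub_add_cancel (by omega), hαn, zero_add, pow_one, one_pow] at h1
    exact hαd (mul_left_cancel₀ (inv_ne_zero (pow_ne_zero _ hγ0)) h1)
  have hdisj := hsep ((Finset.range w1).image u) ((Finset.range w2).image v)
    (by
      rw [Finset.coe_image, Set.image_subset_iff]
      exact fun r _ => const_mem_RSCode n α (by omega) _)
    (by
      rw [Finset.coe_image, Set.image_subset_iff]
      exact fun j _ => monomial_mem_RSCode n α (by omega) _)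
    (by simpa using by omega) (by simpa using by omega)
    (by
      rw [Finset.disjoint_left]
      intro x hx hx'
      obtain ⟨r, -, rfl⟩ := Finset.mem_image.1 hx
      obtain ⟨j, -, h⟩ := Finset.mem_image.1 hx'
      exact huv r j h.symm)
    (Finset.card_image_le.trans_eq (Finset.card_range _))
    (Finset.card_image_le.trans_eq (Finset.card_range _))
  rw [Set.disjoint_left] at hdisj
  refine @hdisj (fun i => γ ^ (((i : ℕ) + 1) % m % w1)) ?_ ?_
  · exact fun i => ⟨u _, Finset.mem_coe.2 (Finset.mem_image_of_mem u
      (Finset.mem_range.2 (Nat.mod_lt _ hw1))), rfl⟩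
  · intro i
    have hj : ((i : ℕ) + 1) % m / w1 < w2 :=
      Nat.div_lt_of_lt_mul ((Nat.mod_lt _ hm0).trans_le hmw)
    refine ⟨v _, Finset.mem_coe.2 (Finset.mem_image_of_mem v (Finset.mem_range.2 hj)), ?_⟩
    change (γ ^ (w1 * (((i : ℕ) + 1) % m / w1)))⁻¹ * (α ^ ((i : ℕ) + 1)) ^ d = _
    rw [inv_mul_eq_iff_eq_mul₀ (pow_ne_zero _ hγ0), ← pow_add, Nat.div_add_mod, ← pow_mul,
      mul_comm, pow_mul, ← hγ, pow_eq_pow_mod _ hγm]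
end

section
/- Let p be a prime and q a power of p, let w1, w2 be positive integers with at least one of them greater than 1, set r1 = ⌊log_p w1⌋ and r2 = ⌊log_p w2⌋, and let 2 ≤ k ≤ q−1 with (k−1) dividing q. Suppose that (w1/p^{r1})·(w2/p^{r2}) < p, i.e., w1·w2 < p^{r1+r2+1}. If the Reed–Solomon code RS_k(q) is (w1,w2)-separating, then k < (q−1)/(w1·w2) + 1, i.e., (k−1)·w1·w2 < q−1. -/
open scoped Pointwise

section SubspacePolynomial

open Polynomial

variable {F G : Type*} [Field F] [AddCommGroup G] [Fintype G]

/-- The subspace polynomial of the image of `φ`: the product of the linear factors `X - φ g`. -/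
noncomputable def subspacePoly (φ : G →+ F) : F[X] := ∏ g : G, (X - C (φ g))

lemma subspacePoly_monic (φ : G →+ F) : (subspacePoly φ).Monic :=
  monic_prod_of_monic _ _ fun _ _ => monic_X_sub_C _

lemma subspacePoly_natDegree (φ : G →+ F) : (subspacePoly φ).natDegree = Fintype.card G := by
  simp [subspacePoly, natDegree_prod_of_monic _ _ fun g _ => monic_X_sub_C (φ g)]

lemma subspacePoly_eval_add_map (φ : G →+ F) (x : F) (g : G) :
    (subspacePoly φ).eval (φ g + x) = (subspacePoly φ).eval x := by
  simp only [subspacePoly, eval_prod, eval_sub, eval_X, eval_C]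
  refine Fintype.prod_equiv (Equiv.subRight g) _ _ fun h => ?_
  simp only [Equiv.subRight_apply, map_sub]
  ring

lemma subspacePoly_eval_map (φ : G →+ F) (g : G) : (subspacePoly φ).eval (φ g) = 0 := by
  simp only [subspacePoly, eval_prod, eval_sub, eval_X, eval_C]
  exact Finset.prod_eq_zero (Finset.mem_univ g) (sub_self _)

lemma subspacePoly_eval_add {φ : G →+ F} (hφ : Function.Injective φ) (x y : F) :
    (subspacePoly φ).eval (x + y) = (subspacePoly φ).eval x + (subspacePoly φ).eval y := by
  classical
  set L := subspacePoly φ with hL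
  have hcard : 0 < Fintype.card G := Fintype.card_pos
  have hLdeg : L.degree = (Fintype.card G : ℕ) := by
    rw [degree_eq_natDegree (subspacePoly_monic φ).ne_zero, subspacePoly_natDegree]
  have hcomp : (L.comp (X + C y)).Monic := (subspacePoly_monic φ).comp_X_add_C y
  have hcompdeg : (L.comp (X + C y)).degree = L.degree := by
    rw [degree_eq_natDegree hcomp.ne_zero, degree_eq_natDegree (subspacePoly_monic φ).ne_zero,
      natDegree_comp, natDegree_X_add_C, mul_one]
  have hlt : (L.comp (X + C y) - L).degree < (Fintype.card G : ℕ) := by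
    rw [← hLdeg, ← hcompdeg]
    refine degree_sub_lt_left hcompdeg hcomp.ne_zero ?_
    rw [hcomp.leadingCoeff, (subspacePoly_monic φ).leadingCoeff]
  have hzero : L.comp (X + C y) - L - C (L.eval y) = 0 := by
    refine eq_zero_of_degree_lt_of_eval_finset_eq_zero (Finset.univ.image φ) ?_ ?_
    · rw [Finset.card_image_of_injective _ hφ, Finset.card_univ]
      refine (degree_sub_le _ _).trans_lt (max_lt hlt (degree_C_le.trans_lt ?_))
      exact_mod_cast hcard
    · intro z hz
      obtain ⟨g, -, rfl⟩ := Finset.mem_image.1 hz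
      simp [hL, subspacePoly_eval_add_map, subspacePoly_eval_map]
  have h := congrArg (eval x) hzero
  simp only [eval_sub, eval_comp, eval_add, eval_X, eval_C, eval_zero] at h
  linear_combination h

end SubspacePolynomial

section ReedSolomon

open Polynomial

variable {F : Type*} [Field F] [Fintype F] {α : F}

lemma primitive_ne_zero (hα : ∀ x : F, x ≠ 0 → ∃ j : ℕ, α ^ j = x)
    (hF : 3 ≤ Fintype.card F) : α ≠ 0 := by
  classical
  rintro rfl
  have hsub : (Finset.univ : Finset F) ⊆ {0, 1} := by
    intro x _
    by_cases hx : x = 0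
    · simp [hx]
    · obtain ⟨j, rfl⟩ := hα x hx
      rcases j with _ | j <;> simp
  have := (Finset.card_le_card hsub).trans Finset.card_le_two
  rw [Finset.card_univ] at this
  omega

lemma exists_fin_pow_succ_eq (hα : ∀ x : F, x ≠ 0 → ∃ j : ℕ, α ^ j = x)
    (hF : 3 ≤ Fintype.card F) {x : F} (hx : x ≠ 0) :
    ∃ i : Fin (Fintype.card F - 1), α ^ ((i : ℕ) + 1) = x := by
  obtain ⟨j, rfl⟩ := hα x hx
  have hone : α ^ (Fintype.card F - 1) = 1 :=
    FiniteField.pow_card_sub_one_eq_one α (primitive_ne_zero hα hF)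
  refine ⟨⟨(j + (Fintype.card F - 2)) % (Fintype.card F - 1), Nat.mod_lt _ (by omega)⟩, ?_⟩
  have hsum : j + (Fintype.card F - 2) + 1 = j + (Fintype.card F - 1) := by omega
  rw [pow_succ, ← pow_eq_pow_mod _ hone, ← pow_succ, hsum, pow_add, hone, mul_one]

/-- Two disjoint families of polynomials such that at every nonzero point some member of the first
agrees with some member of the second show that a Reed–Solomon code is not separating. -/
lemma not_separating_RSCode (hα : ∀ x : F, x ≠ 0 → ∃ j : ℕ, α ^ j = x)
    (hF : 3 ≤ Fintype.card F) {w1 w2 k : ℕ} (hk : k ≤ Fintype.card F - 1)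
    {P R : Finset F[X]} (hP : ∀ f ∈ P, f.degree < k) (hR : ∀ f ∈ R, f.degree < k)
    (hPR : Disjoint P R) (hPw : P.card ≤ w1) (hRw : R.card ≤ w2)
    (h : ∀ x : F, x ≠ 0 → ∃ f ∈ P, ∃ g ∈ R, f.eval x = g.eval x) :
    ¬ Separating (RSCode F (Fintype.card F - 1) α k) w1 w2 := by
  classical
  intro hsep
  let word : F[X] → Fin (Fintype.card F - 1) → F := fun f i => f.eval (α ^ ((i : ℕ) + 1))
  have hα0 := primitive_ne_zero hα hF
  obtain ⟨f₀, hf₀, g₀, hg₀, -⟩ := h 1 one_ne_zero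
  have hsub : ∀ S : Finset F[X], (∀ f ∈ S, f.degree < k) →
      ((S.image word : Finset _) : Set (Fin (Fintype.card F - 1) → F)) ⊆
        RSCode F (Fintype.card F - 1) α k := by
    intro S hS c hc
    obtain ⟨f, hf, rfl⟩ := Finset.mem_image.1 (Finset.mem_coe.1 hc)
    exact ⟨f, hS f hf, fun _ => rfl⟩
  have hinj : ∀ f g : F[X], f.degree < k → g.degree < k → word f = word g → f = g := by
    intro f g hf hg hfg
    refine eq_of_degree_sub_lt_of_eval_finset_eq (Finset.univ.erase 0) ?_ fun x hx => ?_
    · rw [Finset.card_erase_of_mem (Finset.mem_univ _), Finset.card_univ]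
      exact ((degree_sub_le _ _).trans_lt (max_lt hf hg)).trans_le (by exact_mod_cast hk)
    · obtain ⟨i, rfl⟩ := exists_fin_pow_succ_eq hα hF (Finset.ne_of_mem_erase hx)
      exact congrFun hfg i
  have hdisj : Disjoint (P.image word) (R.image word) := by
    rw [Finset.disjoint_left]
    intro c hc hc'
    obtain ⟨f, hf, rfl⟩ := Finset.mem_image.1 hc
    obtain ⟨g, hg, hgf⟩ := Finset.mem_image.1 hc'
    obtain rfl := hinj g f (hR g hg) (hP f hf) hgf
    exact Finset.disjoint_left.1 hPR hf hg
  choose f hf g hg hfg using fun i : Fin (Fintype.card F - 1) =>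
    h (α ^ ((i : ℕ) + 1)) (pow_ne_zero _ hα0)
  have hdesc := Set.disjoint_left.1 (hsep _ _ (hsub P hP) (hsub R hR)
    (Finset.Nonempty.image ⟨f₀, hf₀⟩ _) (Finset.Nonempty.image ⟨g₀, hg₀⟩ _) hdisj (Finset.card_image_le.trans hPw)
    (Finset.card_image_le.trans hRw))
  refine @hdesc (fun i => (f i).eval (α ^ ((i : ℕ) + 1))) ?_ ?_
  · exact fun i => ⟨word (f i), Finset.mem_coe.2 (Finset.mem_image_of_mem _ (hf i)), rfl⟩
  · exact fun i => ⟨word (g i), Finset.mem_coe.2 (Finset.mem_image_of_mem _ (hg i)), (hfg i).symm⟩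

/-- A subspace polynomial of degree `p ^ s`, shifted by the image of one factor of a complement,
against the constants in the image of the other factor. -/
lemma not_separating_RSCode_of_prime_pow {p s t₁ t₂ : ℕ} (hp : p.Prime)
    (hcard : Fintype.card F = p ^ (s + t₁ + t₂))
    (hα : ∀ x : F, x ≠ 0 → ∃ j : ℕ, α ^ j = x) (hF : 3 ≤ Fintype.card F)
    (hk : p ^ s + 1 ≤ Fintype.card F - 1) {w1 w2 : ℕ} (h1 : p ^ t₁ ≤ w1) (h2 : p ^ t₂ ≤ w2) :
    ¬ Separating (RSCode F (Fintype.card F - 1) α (p ^ s + 1)) w1 w2 := by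
  classical
  have : Fact p.Prime := ⟨hp⟩
  have : CharP F p := charP_of_card_eq_prime_pow hcard
  let : Algebra (ZMod p) F := ZMod.algebra F p
  have hrank : Module.finrank (ZMod p) ((Fin s → ZMod p) × (Fin t₁ → ZMod p) × (Fin t₂ → ZMod p)) =
      Module.finrank (ZMod p) F := by
    have hF' := Module.card_eq_pow_finrank (K := ZMod p) (V := F)
    rw [hcard, ZMod.card] at hF'
    rw [← Nat.pow_right_injective hp.two_le hF']
    simp [add_assoc]
  let e := LinearEquiv.ofFinrankEq _ F hrank
  let φ : (Fin s → ZMod p) →+ F :=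
    (e.toLinearMap ∘ₗ LinearMap.inl (ZMod p) _ _).toAddMonoidHom
  have hφ : Function.Injective φ := e.injective.comp fun a b hab => (Prod.ext_iff.1 hab).1
  set L := subspacePoly φ with hL
  have hdeg : L.natDegree = p ^ s := by simp [hL, subspacePoly_natDegree]
  have hpos : 0 < p ^ s := pow_pos hp.pos s
  refine not_separating_RSCode hα hF hk
    (P := Finset.univ.image fun a : Fin t₁ → ZMod p => L - C (L.eval (e (0, a, 0))))
    (R := Finset.univ.image fun b : Fin t₂ → ZMod p => C (L.eval (e (0, 0, b)))) ?_ ?_ ?_ ?_ ?_ ?_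
  · intro f hf
    obtain ⟨a, -, rfl⟩ := Finset.mem_image.1 hf
    refine degree_le_natDegree.trans_lt ?_
    rw [natDegree_sub_C, hdeg]
    exact_mod_cast Nat.lt_succ_self _
  · intro f hf
    obtain ⟨b, -, rfl⟩ := Finset.mem_image.1 hf
    refine degree_C_le.trans_lt ?_
    exact_mod_cast Nat.succ_pos _
  · rw [Finset.disjoint_left]
    intro f hf hf'
    obtain ⟨a, -, rfl⟩ := Finset.mem_image.1 hf
    obtain ⟨b, -, hb⟩ := Finset.mem_image.1 hf'
    have := congrArg natDegree hb
    rw [natDegree_C, natDegree_sub_C, hdeg] at this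
    omega
  · refine Finset.card_image_le.trans ?_
    simpa using h1
  · refine Finset.card_image_le.trans ?_
    simpa using h2
  · intro x _
    obtain ⟨⟨u, a, b⟩, rfl⟩ := e.surjective x
    refine ⟨_, Finset.mem_image_of_mem _ (Finset.mem_univ a), _,
      Finset.mem_image_of_mem _ (Finset.mem_univ b), ?_⟩
    have hsplit : e (u, a, b) = φ u + (e (0, a, 0) + e (0, 0, b)) := by
      change e (u, a, b) = e (u, 0) + _
      rw [← map_add, ← map_add]
      simp
    rw [hsplit, eval_sub, eval_C, eval_C, hL, subspacePoly_eval_add_map, subspacePoly_eval_add hφ]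
    ring

/-- Lines through the origin with slopes `α ^ i`, `i < w1`, against the constants
`α ^ (w1 * (j + 1))`, `j < w2`. -/
lemma not_separating_RSCode_two (hα : ∀ x : F, x ≠ 0 → ∃ j : ℕ, α ^ j = x)
    (hF : 3 ≤ Fintype.card F) {w1 w2 : ℕ} (hw : w1 * w2 = Fintype.card F - 1) :
    ¬ Separating (RSCode F (Fintype.card F - 1) α 2) w1 w2 := by
  classical
  have hα0 := primitive_ne_zero hα hF
  refine not_separating_RSCode hα hF (by omega)
    (P := (Finset.range w1).image fun i => C (α ^ i) * X)
    (R := (Finset.range w2).image fun j => C (α ^ (w1 * (j + 1)))) ?_ ?_ ?_ ?_ ?_ ?_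
  · intro f hf
    obtain ⟨i, -, rfl⟩ := Finset.mem_image.1 hf
    exact (degree_C_mul_X_le _).trans_lt (by norm_num)
  · intro f hf
    obtain ⟨j, -, rfl⟩ := Finset.mem_image.1 hf
    exact degree_C_le.trans_lt (by norm_num)
  · rw [Finset.disjoint_left]
    intro f hf hf'
    obtain ⟨i, -, rfl⟩ := Finset.mem_image.1 hf
    obtain ⟨j, -, hj⟩ := Finset.mem_image.1 hf'
    have := congrArg natDegree hj
    rw [natDegree_C, natDegree_C_mul_X _ (pow_ne_zero _ hα0)] at this
    omega
  · exact Finset.card_image_le.trans (Finset.card_range _).le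
  · exact Finset.card_image_le.trans (Finset.card_range _).le
  · intro x hx
    obtain ⟨⟨t, ht⟩, rfl⟩ := exists_fin_pow_succ_eq hα hF hx
    have hw1 : 0 < w1 := Nat.pos_of_ne_zero fun h => by simp [h] at hw; omega
    have hmod := Nat.mod_lt t hw1
    have hdiv := Nat.div_add_mod t w1
    refine ⟨_, Finset.mem_image_of_mem _ (Finset.mem_range.2 (?_ : w1 - 1 - t % w1 < w1)), _,
      Finset.mem_image_of_mem _ (Finset.mem_range.2 (?_ : t / w1 < w2)), ?_⟩
    · omega
    · exact Nat.div_lt_of_lt_mul (hw ▸ ht)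
    · rw [eval_mul, eval_C, eval_X, eval_C, ← pow_add]
      congr 1
      rw [mul_add]
      simp only
      omega

end ReedSolomon

/-- Condition (2) of Theorem 5: if `k - 1` divides `q` and
`w1 · w2 < p ^ (⌊log_p w1⌋ + ⌊log_p w2⌋ + 1)`, and `RS_k(q)` is `(w1, w2)`-separating,
then `(k - 1) · w1 · w2 < q - 1`. -/
theorem RS_separating_dim_bound_cond2 {p m : ℕ} (hp : p.Prime)
    {F : Type*} [Field F] [Fintype F] {q : ℕ}
    (hq : Fintype.card F = q) (hpq : q = p ^ m)
    (α : F) (hα : ∀ x : F, x ≠ 0 → ∃ j : ℕ, α ^ j = x)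
    {w1 w2 : ℕ} (hw1 : 1 ≤ w1) (hw2 : 1 ≤ w2) (hw : 1 < w1 ∨ 1 < w2)
    {k : ℕ} (hk2 : 2 ≤ k) (hkq : k ≤ q - 1) (hdvd : (k - 1) ∣ q)
    (hcond : w1 * w2 < p ^ (Nat.log p w1 + Nat.log p w2 + 1))
    (hsep : Separating (RSCode F (q - 1) α k) w1 w2) :
    (k - 1) * w1 * w2 < q - 1 := by
  subst hq
  obtain ⟨s, hsm, hs⟩ := (Nat.dvd_prime_pow hp).1 (hpq ▸ hdvd)
  obtain rfl : k = p ^ s + 1 := by omega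
  have hF : 3 ≤ Fintype.card F := by omega
  rw [Nat.add_sub_cancel, mul_assoc]
  by_cases hr : m ≤ s + Nat.log p w1 + Nat.log p w2
  · refine absurd hsep (not_separating_RSCode_of_prime_pow (t₁ := min (Nat.log p w1) (m - s))
      (t₂ := m - s - min (Nat.log p w1) (m - s)) hp ?_ hα hF hkq ?_ ?_)
    · rw [hpq]
      congr 1
      omega
    · exact (Nat.pow_le_pow_right hp.pos (min_le_left _ _)).trans
        (Nat.pow_log_le_self p (by omega))
    · exact (Nat.pow_le_pow_right hp.pos (by omega)).trans (Nat.pow_log_le_self p (by omega))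
  · have hlt : p ^ s * (w1 * w2) < Fintype.card F := by
      calc p ^ s * (w1 * w2) < p ^ s * p ^ (Nat.log p w1 + Nat.log p w2 + 1) :=
            Nat.mul_lt_mul_of_pos_left hcond (pow_pos hp.pos s)
        _ = p ^ (s + (Nat.log p w1 + Nat.log p w2 + 1)) := (pow_add _ _ _).symm
        _ ≤ p ^ m := Nat.pow_le_pow_right hp.pos (by omega)
        _ = Fintype.card F := hpq.symm
    refine lt_of_le_of_ne (by omega) fun heq => ?_
    have hone : p ^ s = 1 := by
      rw [← Nat.dvd_one]
      have hsub : p ^ s ∣ Fintype.card F - (Fintype.card F - 1) :=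
        Nat.dvd_sub (hpq ▸ pow_dvd_pow p hsm) (heq ▸ Dvd.intro _ rfl)
      rwa [Nat.sub_sub_self (by omega)] at hsub
    rw [hone] at hsep heq
    exact not_separating_RSCode_two hα hF (by rwa [one_mul] at heq) hsep
end

section
/- Let p be a prime and q a power of p, let w1, w2 be positive integers with at least one of them greater than 1, set r1 = ⌊log_p w1⌋ and r2 = ⌊log_p w2⌋, and let 2 ≤ k ≤ q−1 with (k−1) dividing q. Suppose that ⌊w1/p^{r1}⌋·⌊w2/p^{r2}⌋ ≥ p. If the Reed–Solomon code RS_k(q) is (w1,w2)-separating, then k < (q−1)/(w1·w2) + 1, i.e., (k−1)·w1·w2 < q−1. -/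
open scoped Pointwise

theorem LinearMap.exists_surjective_of_finrank_le {K V V' : Type*} [Field K]
    [AddCommGroup V] [Module K V] [FiniteDimensional K V]
    [AddCommGroup V'] [Module K V'] [FiniteDimensional K V']
    (h : Module.finrank K V' ≤ Module.finrank K V) :
    ∃ f : V →ₗ[K] V', Function.Surjective f := by
  let b := Module.finBasis K V
  let b' := Module.finBasis K V'
  refine ⟨b.constr K fun i => if hi : (i : ℕ) < Module.finrank K V' then b' ⟨i, hi⟩ else 0, ?_⟩
  rw [← LinearMap.range_eq_top, eq_top_iff, ← b'.span_eq, Submodule.span_le]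
  rintro _ ⟨i, rfl⟩
  refine ⟨b (Fin.castLE h i), ?_⟩
  rw [Module.Basis.constr_basis, dif_pos (by simp)]
  rfl

/-- For every `s` up to the degree of a finite field `F` over its prime field there is a nonzero
linearized polynomial `∑ i ≤ s, c i * X ^ p ^ i` whose kernel has dimension at least `s`. -/
theorem exists_linearized_finrank_ker_ge {p : ℕ} [Fact p.Prime] {F : Type*} [Field F] [Finite F]
    [Algebra (ZMod p) F] {s : ℕ} (hs : s ≤ Module.finrank (ZMod p) F) :
    ∃ (c : Fin (s + 1) → F) (T : F →ₗ[ZMod p] F), c ≠ 0 ∧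
      (∀ x, T x = ∑ i, c i * x ^ p ^ (i : ℕ)) ∧ s ≤ Module.finrank (ZMod p) (LinearMap.ker T) := by
  have := charP_of_injective_algebraMap (algebraMap (ZMod p) F).injective p
  let v : Fin s → F := fun j => Module.finBasis (ZMod p) F (Fin.castLE hs j)
  have hv : LinearIndependent (ZMod p) v :=
    (Module.finBasis (ZMod p) F).linearIndependent.comp _ (Fin.castLE_injective hs)
  let A : Matrix (Fin s) (Fin (s + 1)) F := fun j i => v j ^ p ^ (i : ℕ)
  obtain ⟨c, hc, hc0⟩ := (Submodule.ne_bot_iff _).1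
    (A.mulVecLin.ker_ne_bot_of_finrank_lt (by simp))
  let T₀ : F →+ F := ∑ i : Fin (s + 1),
    (AddMonoidHom.mulLeft (c i)).comp (iterateFrobenius F p i).toAddMonoidHom
  have hT : ∀ x, T₀.toZModLinearMap p x = ∑ i, c i * x ^ p ^ (i : ℕ) := by
    intro x
    simp [T₀, AddMonoidHom.finsetSum_apply, iterateFrobenius_def]
  refine ⟨c, T₀.toZModLinearMap p, hc0, hT, ?_⟩
  have hspan : Submodule.span (ZMod p) (Set.range v) ≤
      LinearMap.ker (T₀.toZModLinearMap p) := by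
    rw [Submodule.span_le]
    rintro _ ⟨j, rfl⟩
    have hvj : ∑ i : Fin (s + 1), v j ^ p ^ (i : ℕ) * c i = 0 :=
      congrFun (LinearMap.mem_ker.1 hc) j
    rw [SetLike.mem_coe, LinearMap.mem_ker, hT, ← hvj]
    exact Finset.sum_congr rfl fun i _ => mul_comm _ _
  simpa [finrank_span_eq_card hv] using Submodule.finrank_mono hspan

/-- A vector space over `ZMod p` of dimension at most `r₁ + r₂ + 1` is the sum of two sets of sizes
at most `a₁ * p ^ r₁` and `a₂ * p ^ r₂` whenever `p ≤ a₁ * a₂`. -/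
theorem exists_finset_add_cover {p : ℕ} [Fact p.Prime] {W : Type*} [AddCommGroup W]
    [Module (ZMod p) W] [FiniteDimensional (ZMod p) W] {a₁ a₂ r₁ r₂ : ℕ} (ha : p ≤ a₁ * a₂)
    (hW : Module.finrank (ZMod p) W ≤ r₁ + r₂ + 1) :
    ∃ A B : Finset W, A.card ≤ a₁ * p ^ r₁ ∧ B.card ≤ a₂ * p ^ r₂ ∧
      ∀ w, ∃ a ∈ A, ∃ b ∈ B, w = a + b := by
  classical
  obtain ⟨f, hf⟩ := LinearMap.exists_surjective_of_finrank_le (K := ZMod p)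
    (V := ((Fin r₁ → ZMod p) × (Fin r₂ → ZMod p)) × ZMod p) (V' := W) (by simpa using hW)
  refine ⟨(Finset.range a₁ ×ˢ (Finset.univ : Finset (Fin r₁ → ZMod p))).image
      fun x => f ((x.2, 0), x.1),
    (Finset.range a₂ ×ˢ (Finset.univ : Finset (Fin r₂ → ZMod p))).image
      fun x => f ((0, x.2), a₁ * x.1), ?_, ?_, fun w => ?_⟩
  · exact Finset.card_image_le.trans (by simp [ZMod.card])
  · exact Finset.card_image_le.trans (by simp [ZMod.card])
  · obtain ⟨⟨⟨x, y⟩, z⟩, rfl⟩ := hf w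
    have hz : z.val < a₁ * a₂ := (ZMod.val_lt z).trans_le ha
    have ha₁ : 0 < a₁ := Nat.pos_of_ne_zero fun h => by simp [h] at hz
    refine ⟨_, Finset.mem_image_of_mem _ (Finset.mk_mem_product (a := z.val % a₁) (b := x)
        (Finset.mem_range.2 (Nat.mod_lt _ ha₁)) (Finset.mem_univ _)),
      _, Finset.mem_image_of_mem _ (Finset.mk_mem_product (a := z.val / a₁) (b := y)
        (Finset.mem_range.2 (Nat.div_lt_of_lt_mul hz)) (Finset.mem_univ _)), ?_⟩
    rw [← map_add]
    congr 1
    ext1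
    · simp
    · have := congrArg (Nat.cast (R := ZMod p)) (Nat.mod_add_div z.val a₁)
      simpa using this.symm

/-- A polynomial of degree less than `q - 1` vanishing at all `α ^ 1, …, α ^ (q - 1)` is zero. -/
theorem Polynomial.eq_zero_of_eval_primitive_pow {F : Type*} [Field F] [Fintype F] {α : F}
    (hα0 : α ≠ 0) (hα : ∀ x : F, x ≠ 0 → ∃ j : ℕ, α ^ j = x) {P : Polynomial F}
    (hP : P.natDegree < Fintype.card F - 1)
    (h : ∀ i : Fin (Fintype.card F - 1), P.eval (α ^ ((i : ℕ) + 1)) = 0) : P = 0 := by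
  classical
  have hn : 0 < Fintype.card F - 1 := by omega
  have hα1 := FiniteField.pow_card_sub_one_eq_one α hα0
  refine Polynomial.eq_zero_of_natDegree_lt_card_of_eval_eq_zero' P (Finset.univ.erase 0) ?_ ?_
  · intro x hx
    obtain ⟨j, rfl⟩ := hα x (Finset.ne_of_mem_erase hx)
    have key := h ⟨(j + (Fintype.card F - 1 - 1)) % (Fintype.card F - 1), Nat.mod_lt _ hn⟩
    rwa [pow_succ, ← pow_eq_pow_mod _ hα1, ← pow_succ, add_assoc, Nat.sub_add_cancel hn,
      pow_add, hα1, mul_one] at key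
  · simpa [Finset.card_erase_of_mem] using hP

theorem Polynomial.natDegree_linearized_sub_C_le {R : Type*} [Ring R] {p s : ℕ} (hp : 0 < p)
    (c : Fin (s + 1) → R) (b : R) :
    (∑ j, Polynomial.C (c j) * Polynomial.X ^ p ^ (j : ℕ) - Polynomial.C b).natDegree ≤ p ^ s := by
  rw [Polynomial.natDegree_sub_C]
  exact Polynomial.natDegree_sum_le_of_forall_le _ _ fun j _ =>
    (Polynomial.natDegree_C_mul_X_pow_le _ _).trans
      (Nat.pow_le_pow_right hp (Nat.le_of_lt_succ j.2))

/-- A nonconstant linearized polynomial of degree at most `p ^ s < q - 1` is not constant on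
`α ^ 1, …, α ^ (q - 1)`. -/
theorem exists_eval_linearized_ne {p : ℕ} (hp : p.Prime) {F : Type*} [Field F] [Fintype F] {α : F}
    (hα0 : α ≠ 0) (hα : ∀ x : F, x ≠ 0 → ∃ j : ℕ, α ^ j = x) {s : ℕ} {c : Fin (s + 1) → F}
    (hc : c ≠ 0) (hs : p ^ s < Fintype.card F - 1) (b : F) :
    ∃ i : Fin (Fintype.card F - 1), ∑ j, c j * (α ^ ((i : ℕ) + 1)) ^ p ^ (j : ℕ) ≠ b := by
  by_contra! h
  have hP := Polynomial.eq_zero_of_eval_primitive_pow hα0 hα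
    (P := ∑ j, Polynomial.C (c j) * Polynomial.X ^ p ^ (j : ℕ) - Polynomial.C b) ?_ ?_
  · refine hc (funext fun j => ?_)
    have hcoeff := congrArg (fun P => P.coeff (p ^ (j : ℕ))) hP
    simpa [Polynomial.coeff_C, Polynomial.finsetSum_coeff, Polynomial.coeff_X_pow,
      hp.ne_zero, Nat.pow_right_inj hp.two_le, Fin.val_inj] using hcoeff
  · exact (Polynomial.natDegree_linearized_sub_C_le hp.pos c b).trans_lt hs
  · intro i
    simp [Polynomial.eval_finsetSum, h i]

/-- If `p ^ m - 1 ≤ p ^ s * w₁ * w₂` with `s < m`, then the product `w₁ * w₂` has enough digits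
in base `p`. -/
theorem le_add_log_of_pow_sub_one_le {p m s w₁ w₂ : ℕ} (hp : 1 < p)
    (h : p ^ m - 1 ≤ p ^ s * w₁ * w₂) :
    m ≤ s + (Nat.log p w₁ + Nat.log p w₂ + 1) := by
  by_contra! hm
  have h₁ := Nat.lt_pow_succ_log_self hp w₁
  have h₂ := Nat.lt_pow_succ_log_self hp w₂
  have hpow : p ^ s * (p ^ (Nat.log p w₁ + 1) * p ^ (Nat.log p w₂ + 1)) ≤ p ^ m := by
    rw [← pow_add, ← pow_add]
    exact Nat.pow_le_pow_right hp.le (by omega)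
  have hs : 1 ≤ p ^ s := Nat.one_le_pow _ _ hp.le
  have e₁ : 2 ≤ p ^ (Nat.log p w₁ + 1) := Nat.succ_le_of_lt (Nat.one_lt_pow (by omega) hp)
  have e₂ : 2 ≤ p ^ (Nat.log p w₂ + 1) := Nat.succ_le_of_lt (Nat.one_lt_pow (by omega) hp)
  have hprod : w₁ * w₂ + 2 ≤ p ^ (Nat.log p w₁ + 1) * p ^ (Nat.log p w₂ + 1) := by
    obtain ⟨x, hx⟩ := Nat.exists_eq_add_of_le' e₁
    obtain ⟨y, hy⟩ := Nat.exists_eq_add_of_le' e₂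
    rw [Nat.succ_eq_add_one, hx] at h₁
    rw [Nat.succ_eq_add_one, hy] at h₂
    rw [hx, hy]
    nlinarith [Nat.mul_le_mul (Nat.le_of_lt_succ h₁) (Nat.le_of_lt_succ h₂)]
  have hmul := Nat.mul_le_mul_left (p ^ s) hprod
  rw [mul_assoc] at h
  rw [mul_add] at hmul
  omega

/-- Condition (3) of Theorem 5: if `k - 1` divides `q` and
`⌊w1 / p^⌊log_p w1⌋⌋ · ⌊w2 / p^⌊log_p w2⌋⌋ ≥ p`, and `RS_k(q)` is
`(w1, w2)`-separating, then `(k - 1) · w1 · w2 < q - 1`. -/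
theorem RS_separating_dim_bound_cond3 {p m : ℕ} (hp : p.Prime)
    {F : Type*} [Field F] [Fintype F] {q : ℕ}
    (hq : Fintype.card F = q) (hpq : q = p ^ m)
    (α : F) (hα : ∀ x : F, x ≠ 0 → ∃ j : ℕ, α ^ j = x)
    {w1 w2 : ℕ} (hw1 : 1 ≤ w1) (hw2 : 1 ≤ w2) (hw : 1 < w1 ∨ 1 < w2)
    {k : ℕ} (hk2 : 2 ≤ k) (hkq : k ≤ q - 1) (hdvd : (k - 1) ∣ q)
    (hcond : p ≤ (w1 / p ^ Nat.log p w1) * (w2 / p ^ Nat.log p w2))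
    (hsep : Separating (RSCode F (q - 1) α k) w1 w2) :
    (k - 1) * w1 * w2 < q - 1 := by
  classical
  by_contra! hle
  have : Fact p.Prime := ⟨hp⟩
  have : CharP F p := charP_of_card_eq_prime_pow (hq.trans hpq)
  let _ : Algebra (ZMod p) F := ZMod.algebra F p
  have hrank : Module.finrank (ZMod p) F = m := by
    have hcard := Module.card_eq_pow_finrank (K := ZMod p) (V := F)
    rw [hq, hpq, ZMod.card] at hcard
    exact (Nat.pow_right_injective hp.two_le hcard).symm
  obtain ⟨s, hsm, hs⟩ := (Nat.dvd_prime_pow hp).1 (hpq ▸ hdvd)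
  subst hq
  have hα0 : α ≠ 0 := by
    rintro rfl
    obtain ⟨x, hx⟩ := Finset.exists_mem_notMem_of_card_lt_card (s := ({0, 1} : Finset F))
      (t := Finset.univ) (Finset.card_le_two.trans_lt (by rw [Finset.card_univ]; omega))
    simp only [Finset.mem_insert, Finset.mem_singleton, not_or] at hx
    obtain ⟨j, hj⟩ := hα x hx.2.1
    rcases Nat.eq_zero_or_pos j with rfl | hj0
    · exact hx.2.2 (by simpa using hj.symm)
    · exact hx.2.1 (by rw [← hj, zero_pow hj0.ne'])
  obtain ⟨c, T, hc, hT, hker⟩ :=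
    exists_linearized_finrank_ker_ge (p := p) (F := F) (s := s) (hsm.trans hrank.ge)
  have hm := le_add_log_of_pow_sub_one_le (p := p) (m := m) (s := s) (w₁ := w1) (w₂ := w2)
    hp.one_lt (by rwa [hpq, hs] at hle)
  have hrn := T.finrank_range_add_finrank_ker
  obtain ⟨A, B, hA, hB, hAB⟩ := exists_finset_add_cover (p := p) (W := LinearMap.range T)
    (r₁ := Nat.log p w1) (r₂ := Nat.log p w2) hcond (by omega)
  let u : LinearMap.range T → Fin (Fintype.card F - 1) → F := fun a _ => a
  let v : LinearMap.range T → Fin (Fintype.card F - 1) → F :=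
    fun b i => T (α ^ ((i : ℕ) + 1)) - b
  obtain ⟨a₀, ha₀, b₀, hb₀, -⟩ := hAB 0
  have hdisj : Disjoint (A.image u) (B.image v) := by
    simp only [Finset.disjoint_left, Finset.mem_image, not_exists, not_and]
    rintro _ ⟨a, -, rfl⟩ b - hab
    obtain ⟨i, hi⟩ := exists_eval_linearized_ne hp hα0 hα hc (by omega) ((a : F) + b)
    exact hi (by rw [← hT, ← sub_eq_iff_eq_add]; exact congrFun hab i)
  have hsub := hsep (A.image u) (B.image v) ?_ ?_ (.image ⟨a₀, ha₀⟩ _) (.image ⟨b₀, hb₀⟩ _) hdisj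
    (Finset.card_image_le.trans (hA.trans (Nat.div_mul_le_self _ _)))
    (Finset.card_image_le.trans (hB.trans (Nat.div_mul_le_self _ _)))
  · choose f hfA g hgB hfg using hAB
    let w : Fin (Fintype.card F - 1) → LinearMap.range T :=
      fun i => ⟨T (α ^ ((i : ℕ) + 1)), LinearMap.mem_range_self _ _⟩
    refine Set.disjoint_left.1 hsub
      (show (fun i => (f (w i) : F)) ∈ _ from fun i => ?_) fun i => ?_
    · exact ⟨u (f (w i)), Finset.mem_coe.2 (Finset.mem_image_of_mem _ (hfA _)), rfl⟩
    · refine ⟨v (g (w i)), Finset.mem_coe.2 (Finset.mem_image_of_mem _ (hgB _)), ?_⟩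
      have h := congrArg Subtype.val (hfg (w i))
      exact sub_eq_iff_eq_add.2 h
  · intro x hx
    obtain ⟨a, -, rfl⟩ := Finset.mem_image.1 (Finset.mem_coe.1 hx)
    exact ⟨Polynomial.C (a : F), Polynomial.degree_C_le.trans_lt (by exact_mod_cast (by omega)),
      fun i => by simp [u]⟩
  · intro x hx
    obtain ⟨b, -, rfl⟩ := Finset.mem_image.1 (Finset.mem_coe.1 hx)
    refine ⟨∑ j, Polynomial.C (c j) * Polynomial.X ^ p ^ (j : ℕ) - Polynomial.C (b : F), ?_,
      fun i => by simp [v, hT, Polynomial.eval_finsetSum]⟩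
    refine (Polynomial.degree_le_of_natDegree_le
      (Polynomial.natDegree_linearized_sub_C_le hp.pos c _)).trans_lt ?_
    exact_mod_cast (by omega)
end

section
/- Let w1, w2 be positive integers with at least one of them greater than 1, and let 1 ≤ k ≤ q−1. Suppose that w1·w2 ≥ q−1 or that w1·w2 divides q−1. If the Reed–Solomon code RS_k(q) is (w1,w2)-separating, then k < (q−1)/(w1·w2) + 1, i.e., (k−1)·w1·w2 < q−1. -/
open scoped Pointwise

open Polynomial in
/-- If every power of `α ^ d` is one of its first `w1 * w2` powers, then the words of
`(α ^ d) ^ (-i) * X ^ d` for `i < w1` and of the constants `(α ^ d) ^ (w1 * j)` for `j < w2`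
witness that the Reed–Solomon code is not separating. -/
lemma not_separating_RSCode_s9 {F : Type*} [Field F] {n k d w1 w2 : ℕ} {α : F} (hα : α ≠ 0)
    (hw1 : 1 ≤ w1) (hw2 : 1 ≤ w2) (hn : 2 ≤ n) (hd : d < k) (hd1 : α ^ d ≠ 1)
    (hcover : ∀ m : ℕ, ∃ l < w1 * w2, (α ^ d) ^ m = (α ^ d) ^ l) :
    ¬ Separating (RSCode F n α k) w1 w2 := by
  classical
  intro hsep
  have hγ : α ^ d ≠ 0 := pow_ne_zero _ hα
  let f : ℕ → Fin n → F := fun i t => ((α ^ d) ^ i)⁻¹ * (α ^ ((t : ℕ) + 1)) ^ d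
  let g : ℕ → Fin n → F := fun j _ => (α ^ d) ^ (w1 * j)
  have hU : ((Finset.range w1).image f : Set (Fin n → F)) ⊆ RSCode F n α k := by
    intro c hc
    obtain ⟨i, -, rfl⟩ := Finset.mem_image.1 (Finset.mem_coe.1 hc)
    refine ⟨C ((α ^ d) ^ i)⁻¹ * X ^ d, ?_, fun t => by simp [f]⟩
    exact (degree_C_mul_X_pow_le _ _).trans_lt (by exact_mod_cast hd)
  have hV : ((Finset.range w2).image g : Set (Fin n → F)) ⊆ RSCode F n α k := by
    intro c hc
    obtain ⟨j, -, rfl⟩ := Finset.mem_image.1 (Finset.mem_coe.1 hc)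
    refine ⟨C ((α ^ d) ^ (w1 * j)), ?_, fun t => by simp [g]⟩
    exact degree_C_le.trans_lt (by exact_mod_cast (Nat.zero_le d).trans_lt hd)
  have hUV : Disjoint ((Finset.range w1).image f) ((Finset.range w2).image g) := by
    rw [Finset.disjoint_left]
    intro c hcU hcV
    obtain ⟨i, -, rfl⟩ := Finset.mem_image.1 hcU
    obtain ⟨j, -, hj⟩ := Finset.mem_image.1 hcV
    have h0 := congrFun hj ⟨0, by omega⟩
    have h1 := congrFun hj ⟨1, by omega⟩
    have h := mul_left_cancel₀ (inv_ne_zero (pow_ne_zero i hγ)) (h0.symm.trans h1)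
    simp only [zero_add, pow_one, pow_succ α 1, mul_pow] at h
    exact hd1 (mul_left_cancel₀ hγ (by rw [mul_one]; exact h.symm))
  have hagree : ∀ t : Fin n, ∃ i < w1, ∃ j < w2, f i t = g j t := by
    intro t
    obtain ⟨l, hl, hlt⟩ := hcover (t + 1)
    refine ⟨l % w1, Nat.mod_lt _ hw1, l / w1, Nat.div_lt_of_lt_mul hl, ?_⟩
    change ((α ^ d) ^ (l % w1))⁻¹ * (α ^ ((t : ℕ) + 1)) ^ d = (α ^ d) ^ (w1 * (l / w1))
    rw [pow_right_comm α (t + 1), hlt, inv_mul_eq_iff_eq_mul₀ (pow_ne_zero _ hγ), ← pow_add, Nat.mod_add_div]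
  choose a ha b hb hab using hagree
  have hdisj := hsep _ _ hU hV
    ((Finset.nonempty_range_iff.2 (by omega)).image f)
    ((Finset.nonempty_range_iff.2 (by omega)).image g) hUV
    (Finset.card_image_le.trans (Finset.card_range w1).le)
    (Finset.card_image_le.trans (Finset.card_range w2).le)
  refine hdisj.notMem_of_mem_left (a := fun t => f (a t) t) (fun t => ⟨f (a t), ?_, rfl⟩)
    (fun t => ⟨g (b t), ?_, (hab t).symm⟩)
  · exact Finset.mem_coe.2 (Finset.mem_image_of_mem f (Finset.mem_range.2 (ha t)))
  · exact Finset.mem_coe.2 (Finset.mem_image_of_mem g (Finset.mem_range.2 (hb t)))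

/-- If the nonzero elements of a finite field are all among the first `d` powers of `α`, then
there are at most `d` of them. -/
lemma card_sub_one_le_of_forall_exists_pow {F : Type*} [Field F] [Fintype F] {α : F} {d : ℕ}
    (h : ∀ x : F, x ≠ 0 → ∃ m < d, α ^ m = x) : Fintype.card F - 1 ≤ d := by
  classical
  have hsub : (Finset.univ.erase (0 : F)) ⊆ (Finset.range d).image (α ^ ·) := by
    intro x hx
    obtain ⟨m, hm, rfl⟩ := h x (Finset.ne_of_mem_erase hx)
    exact Finset.mem_image_of_mem _ (Finset.mem_range.2 hm)
  have hcard := (Finset.card_le_card hsub).trans Finset.card_image_le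
  rwa [Finset.card_erase_of_mem (Finset.mem_univ _), Finset.card_univ,
    Finset.card_range] at hcard

/-- Corollary 1: if `w1 · w2 ≥ q - 1` or `w1 · w2 ∣ q - 1`, and `RS_k(q)` is
`(w1, w2)`-separating, then `(k - 1) · w1 · w2 < q - 1`. -/
theorem RS_separating_dim_bound_cor1 {F : Type*} [Field F] [Fintype F] {q : ℕ}
    (hq : Fintype.card F = q) (α : F) (hα : ∀ x : F, x ≠ 0 → ∃ m : ℕ, α ^ m = x)
    {w1 w2 : ℕ} (hw1 : 1 ≤ w1) (hw2 : 1 ≤ w2) (hw : 1 < w1 ∨ 1 < w2)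
    {k : ℕ} (hk1 : 1 ≤ k) (hkq : k ≤ q - 1)
    (hcond : q - 1 ≤ w1 * w2 ∨ w1 * w2 ∣ (q - 1))
    (hsep : Separating (RSCode F (q - 1) α k) w1 w2) :
    (k - 1) * w1 * w2 < q - 1 := by
  subst hq
  by_contra! hle
  have hk : 2 ≤ k := by
    by_contra! hk
    obtain rfl : k = 1 := by omega
    simp only [Nat.sub_self, zero_mul] at hle
    omega
  have hα0 : α ≠ 0 := by
    rintro rfl
    have := card_sub_one_le_of_forall_exists_pow (α := (0 : F)) (d := 1) fun x hx => by
      obtain ⟨m, rfl⟩ := hα x hx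
      exact ⟨0, one_pos, by rcases m with _ | m <;> simp_all⟩
    omega
  have hord : ∀ d, 0 < d → d < Fintype.card F - 1 → α ^ d ≠ 1 := by
    intro d hd hdn h1
    have := card_sub_one_le_of_forall_exists_pow (α := α) (d := d) fun x hx => by
      obtain ⟨m, rfl⟩ := hα x hx
      exact ⟨m % d, Nat.mod_lt _ hd, (pow_eq_pow_mod m h1).symm⟩
    omega
  have hαn : α ^ (Fintype.card F - 1) = 1 := FiniteField.pow_card_sub_one_eq_one α hα0
  have hn : 2 ≤ Fintype.card F - 1 := hk.trans hkq
  rcases hcond with hc | ⟨d, hd⟩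
  · refine not_separating_RSCode_s9 (d := 1) hα0 hw1 hw2 hn hk (hord 1 one_pos hn) ?_ hsep
    intro m
    rw [pow_one]
    exact ⟨m % _, (Nat.mod_lt _ (by omega)).trans_le hc, pow_eq_pow_mod m hαn⟩
  · have hww : 1 < w1 * w2 := by
      rcases hw with h | h <;> nlinarith
    have hd0 : 0 < d := Nat.pos_of_ne_zero (by rintro rfl; omega)
    have hdk : d ≤ k - 1 := by
      rw [hd, mul_assoc (k - 1), mul_comm (k - 1)] at hle
      exact Nat.le_of_mul_le_mul_left hle (by omega)
    have hdn : d < Fintype.card F - 1 := by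
      rw [hd]
      nlinarith
    refine not_separating_RSCode_s9 hα0 hw1 hw2 hn (by omega) (hord d hd0 hdn) ?_ hsep
    refine fun m => ⟨m % (w1 * w2), Nat.mod_lt _ (by omega), pow_eq_pow_mod m ?_⟩
    rw [← pow_mul, mul_comm d, ← hd, hαn]
end

section
/- Let w1, w2 be positive integers with at least one of them greater than 1, and let 1 ≤ k ≤ q−1. Suppose that w1·w2 divides q. If the Reed–Solomon code RS_k(q) is (w1,w2)-separating, then k < (q−1)/(w1·w2) + 1, i.e., (k−1)·w1·w2 < q−1. -/
open scoped Pointwise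

theorem exists_addSubgroup_card_of_dvd {G : Type*} [AddCommGroup G] [Finite G] {p n d : ℕ}
    [Fact p.Prime] (hG : Nat.card G ∣ p ^ n) (hd : d ∣ Nat.card G) :
    ∃ K : AddSubgroup G, Nat.card K = d := by
  obtain ⟨m, -, rfl⟩ := (Nat.dvd_prime_pow Fact.out).1 (hd.trans hG)
  obtain ⟨K, hK⟩ := Sylow.exists_subgroup_card_pow_prime (G := Multiplicative G) p (n := m) hd
  exact ⟨Subgroup.toAddSubgroup' K, hK⟩

section SubgroupPolynomial

open Polynomial

variable {F : Type*} [Field F]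

/-- The monic polynomial whose roots are the elements of a finite additive subgroup. -/
noncomputable def AddSubgroup.vanishingPoly (W : AddSubgroup F) [Fintype W] : F[X] :=
  ∏ w : W, (X - C (w : F))

variable (W : AddSubgroup F) [Fintype W]

theorem AddSubgroup.monic_vanishingPoly : W.vanishingPoly.Monic :=
  monic_prod_X_sub_C _ _

theorem AddSubgroup.natDegree_vanishingPoly : W.vanishingPoly.natDegree = Nat.card W := by
  rw [vanishingPoly, natDegree_prod_of_monic _ _ fun w _ => monic_X_sub_C _]
  simp

theorem AddSubgroup.degree_vanishingPoly : W.vanishingPoly.degree = Nat.card W := by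
  rw [degree_eq_natDegree W.monic_vanishingPoly.ne_zero, natDegree_vanishingPoly]

theorem AddSubgroup.eval_vanishingPoly_eq_zero_iff (x : F) :
    W.vanishingPoly.eval x = 0 ↔ x ∈ W := by
  simp [vanishingPoly, eval_prod, Finset.prod_eq_zero_iff, sub_eq_zero]

theorem AddSubgroup.eval_vanishingPoly_add_of_mem {w : F} (hw : w ∈ W) (y : F) :
    W.vanishingPoly.eval (w + y) = W.vanishingPoly.eval y := by
  simp only [vanishingPoly, eval_prod, eval_sub, eval_X, eval_C]
  refine Fintype.prod_equiv (Equiv.subRight (⟨w, hw⟩ : W)) _ _ fun v => ?_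
  simp only [Equiv.subRight_apply, AddSubgroup.coe_sub]
  ring

theorem AddSubgroup.eval_vanishingPoly_add (x y : F) :
    W.vanishingPoly.eval (x + y) = W.vanishingPoly.eval x + W.vanishingPoly.eval y := by
  set L := W.vanishingPoly with hL
  have hmonic : L.Monic := W.monic_vanishingPoly
  have hdeg : L.degree = Nat.card W := W.degree_vanishingPoly
  have hpos : 0 < Nat.card W := Nat.card_pos
  have hlt : (L.comp (X + C y) - L - C (L.eval y)).degree < (Nat.card W : ℕ) := by
    refine (degree_sub_le _ _).trans_lt (max_lt ?_ ?_)
    · have hcomp : (L.comp (X + C y)).degree = L.degree := by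
        rw [degree_eq_natDegree (hmonic.comp_X_add_C y).ne_zero,
          degree_eq_natDegree hmonic.ne_zero, natDegree_comp, natDegree_X_add_C, mul_one]
      rw [← hdeg, ← hcomp]
      refine degree_sub_lt_left hcomp (hmonic.comp_X_add_C y).ne_zero ?_
      rw [(hmonic.comp_X_add_C y).leadingCoeff, hmonic.leadingCoeff]
    · exact degree_C_le.trans_lt (by exact_mod_cast hpos)
  have hzero : L.comp (X + C y) - L - C (L.eval y) = 0 := by
    refine eq_zero_of_degree_lt_of_eval_index_eq_zero (Finset.univ : Finset W)
      (v := Subtype.val) Subtype.coe_injective.injOn ?_ ?_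
    · simpa [Nat.card_eq_fintype_card] using hlt
    · intro w _
      simp [eval_comp, hL, W.eval_vanishingPoly_add_of_mem w.2,
        (W.eval_vanishingPoly_eq_zero_iff w).2 w.2]
  have h := congrArg (eval x) hzero
  simp only [eval_sub, eval_comp, eval_add, eval_X, eval_C, eval_zero] at h
  linear_combination h

/-- Evaluation of the vanishing polynomial of an additive subgroup, as an additive map. -/
noncomputable def AddSubgroup.vanishingHom : F →+ F :=
  AddMonoidHom.mk' (fun x => W.vanishingPoly.eval x) W.eval_vanishingPoly_add

theorem AddSubgroup.ker_vanishingHom : W.vanishingHom.ker = W := by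
  ext x
  exact W.eval_vanishingPoly_eq_zero_iff x

theorem AddSubgroup.card_mul_card_range_vanishingHom :
    Nat.card W.vanishingHom.range * Nat.card W = Nat.card F := by
  rw [AddSubgroup.card_eq_card_quotient_mul_card_addSubgroup W.vanishingHom.ker,
    Nat.card_congr (QuotientAddGroup.quotientKerEquivRange W.vanishingHom).toEquiv,
    ker_vanishingHom]

end SubgroupPolynomial

theorem exists_pow_succ_eq {F : Type*} [Field F] [Fintype F] {α : F} (hα0 : α ≠ 0)
    (hα : ∀ x : F, x ≠ 0 → ∃ m : ℕ, α ^ m = x) {x : F} (hx : x ≠ 0) :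
    ∃ i : Fin (Fintype.card F - 1), α ^ ((i : ℕ) + 1) = x := by
  obtain ⟨m, hm⟩ := hα (x * α⁻¹) (mul_ne_zero hx (inv_ne_zero hα0))
  have hpos : 0 < Fintype.card F - 1 := Nat.sub_pos_of_lt Fintype.one_lt_card
  refine ⟨⟨m % (Fintype.card F - 1), Nat.mod_lt _ hpos⟩, ?_⟩
  rw [pow_succ, ← pow_eq_pow_mod m (FiniteField.pow_card_sub_one_eq_one α hα0), hm,
    inv_mul_cancel_right₀ hα0]

theorem primitive_ne_zero_s10 {F : Type*} [Field F] [Fintype F] {α : F}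
    (hcard : 2 < Fintype.card F) (hα : ∀ x : F, x ≠ 0 → ∃ m : ℕ, α ^ m = x) : α ≠ 0 := by
  classical
  rintro rfl
  obtain ⟨x, hx⟩ : ∃ x : F, x ∉ ({0, 1} : Finset F) := by
    by_contra! h
    have := Finset.card_le_card (fun x _ => h x : (Finset.univ : Finset F) ⊆ {0, 1})
    exact absurd (this.trans Finset.card_le_two) (by rw [Finset.card_univ]; omega)
  simp only [Finset.mem_insert, Finset.mem_singleton, not_or] at hx
  obtain ⟨m, hm⟩ := hα x hx.1
  rcases Nat.eq_zero_or_pos m with rfl | h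
  · exact hx.2 (by simpa using hm.symm)
  · exact hx.1 (by rw [← hm, zero_pow h.ne'])

/-- Corollary 2: if `w1 · w2 ∣ q` and `RS_k(q)` is `(w1, w2)`-separating, then
`(k - 1) · w1 · w2 < q - 1`. -/
theorem RS_separating_dim_bound_cor2 {F : Type*} [Field F] [Fintype F] {q : ℕ}
    (hq : Fintype.card F = q) (α : F) (hα : ∀ x : F, x ≠ 0 → ∃ m : ℕ, α ^ m = x)
    {w1 w2 : ℕ} (hw1 : 1 ≤ w1) (hw2 : 1 ≤ w2) (hw : 1 < w1 ∨ 1 < w2)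
    {k : ℕ} (hk1 : 1 ≤ k) (hkq : k ≤ q - 1)
    (hcond : w1 * w2 ∣ q)
    (hsep : Separating (RSCode F (q - 1) α k) w1 w2) :
    (k - 1) * w1 * w2 < q - 1 := by
  classical
  subst hq
  by_contra! hcon
  obtain ⟨N, hN⟩ := hcond
  have hw2' : 2 ≤ w1 * w2 := by
    rcases hw with h | h <;> nlinarith
  have hNk : N < k := by
    rw [mul_assoc, hN] at hcon
    by_contra! h
    have h1 : (k - 1) + 1 ≤ N := by omega
    have h2 := Nat.mul_le_mul_left (w1 * w2) h1
    rw [mul_add, mul_comm (w1 * w2) (k - 1)] at h2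
    omega
  have hNpos : 0 < N := by
    rcases Nat.eq_zero_or_pos N with h | h
    · have := Fintype.card_pos (α := F)
      simp [hN, h] at this
    · exact h
  have hα0 : α ≠ 0 := primitive_ne_zero_s10 (by omega) hα
  obtain ⟨p, hp⟩ := CharP.exists F
  obtain ⟨n, hprime, hpn⟩ := FiniteField.card F p
  have := Fact.mk hprime
  have hdvd : Nat.card F ∣ p ^ (n : ℕ) := by rw [Nat.card_eq_fintype_card, hpn]
  obtain ⟨W, hW⟩ := exists_addSubgroup_card_of_dvd (d := N) hdvd
    (by rw [Nat.card_eq_fintype_card, hN]; exact dvd_mul_left _ _)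
  have hrange : Nat.card W.vanishingHom.range = w1 * w2 := by
    have h := W.card_mul_card_range_vanishingHom
    rw [hW, Nat.card_eq_fintype_card (α := F), hN] at h
    exact Nat.eq_of_mul_eq_mul_right hNpos h
  obtain ⟨A, hA⟩ := exists_addSubgroup_card_of_dvd (G := W.vanishingHom.range) (d := w1)
    ((AddSubgroup.card_addSubgroup_dvd_card _).trans hdvd) (by rw [hrange]; exact dvd_mul_right _ _)
  have hquot : Nat.card (W.vanishingHom.range ⧸ A) = w2 := by
    have h := AddSubgroup.card_eq_card_quotient_mul_card_addSubgroup A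
    rw [hA, hrange, mul_comm] at h
    exact (Nat.eq_of_mul_eq_mul_right hw1 h).symm
  have := Fintype.ofFinite (W.vanishingHom.range ⧸ A)
  set L := W.vanishingPoly with hL
  let u : A → Fin (Fintype.card F - 1) → F :=
    fun a i => L.eval (α ^ ((i : ℕ) + 1)) - ((a : W.vanishingHom.range) : F)
  let v : W.vanishingHom.range ⧸ A → Fin (Fintype.card F - 1) → F :=
    fun t _ => (t.out : F)
  have hLdeg : L.degree = N := by rw [hL, W.degree_vanishingPoly, hW]
  have hdisj : Disjoint (Finset.univ.image u) (Finset.univ.image v) := by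
    rw [Finset.disjoint_left]
    intro c hu hv
    obtain ⟨a, -, rfl⟩ := Finset.mem_image.1 hu
    obtain ⟨t, -, ht⟩ := Finset.mem_image.1 hv
    set P := L - Polynomial.C (((a : W.vanishingHom.range) : F) + (t.out : F)) with hP
    have hPdeg : P.degree = N := by
      rw [hP, Polynomial.degree_sub_C (by rw [hLdeg]; exact_mod_cast hNpos), hLdeg]
    have hzero : P = 0 := by
      refine Polynomial.eq_zero_of_degree_lt_of_eval_finset_eq_zero
        (Finset.univ.erase (0 : F)) ?_ ?_
      · rw [hPdeg, Finset.card_erase_of_mem (Finset.mem_univ _), Finset.card_univ]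
        exact_mod_cast hNk.trans_le hkq
      · intro x hx
        obtain ⟨i, rfl⟩ := exists_pow_succ_eq hα0 hα (Finset.ne_of_mem_erase hx)
        have h := congrFun ht i
        simp only [u, v] at h
        rw [hP, Polynomial.eval_sub, Polynomial.eval_C, h]
        ring
    simp [hzero] at hPdeg
  have hUV := hsep (Finset.univ.image u) (Finset.univ.image v) ?_ ?_
    (Finset.univ_nonempty.image u) (Finset.univ_nonempty.image v) hdisj
    (Finset.card_image_le.trans (by rw [Finset.card_univ, ← Nat.card_eq_fintype_card, hA]))
    (Finset.card_image_le.trans (by rw [Finset.card_univ, ← Nat.card_eq_fintype_card, hquot]))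
  · let z : Fin (Fintype.card F - 1) → W.vanishingHom.range :=
      fun i => ⟨W.vanishingHom (α ^ ((i : ℕ) + 1)), _, rfl⟩
    refine Set.disjoint_left.1 hUV (show (fun i => v (z i) i) ∈ _ from fun i => ?_) fun i =>
      ⟨v (z i), by simp, rfl⟩
    have hmem : -(Quotient.out (z i : W.vanishingHom.range ⧸ A)) + z i ∈ A :=
      QuotientAddGroup.eq.1 (QuotientAddGroup.out_eq' _)
    refine ⟨u ⟨_, hmem⟩, by simp, ?_⟩
    simp only [u, v, AddSubgroup.coe_add, AddSubgroup.coe_neg]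
    change L.eval (α ^ ((i : ℕ) + 1)) - (_ + L.eval (α ^ ((i : ℕ) + 1))) = _
    ring
  · intro c hc
    obtain ⟨a, -, rfl⟩ := Finset.mem_image.1 (Finset.mem_coe.1 hc)
    refine ⟨L - Polynomial.C ((a : W.vanishingHom.range) : F), ?_, fun i => by simp [u]⟩
    rw [Polynomial.degree_sub_C (by rw [hLdeg]; exact_mod_cast hNpos), hLdeg]
    exact_mod_cast hNk
  · intro c hc
    obtain ⟨t, -, rfl⟩ := Finset.mem_image.1 (Finset.mem_coe.1 hc)
    refine ⟨Polynomial.C (t.out : F), ?_, fun i => by simp [v]⟩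
    exact Polynomial.degree_C_le.trans_lt (by exact_mod_cast hk1)
end

section
/- Let w ≥ 2 be an integer and let C be a code of length n over a finite alphabet Q with at least two codewords and minimum distance d. If d > n(1 − 1/w²), i.e., d·w² > n·(w² − 1), then C is a w-IPP code. -/
/-- A code `C` is `w`-IPP if for every word `x` that lies in the descendant set of
at least one nonempty subset of `C` of size at most `w`, the intersection of all such
subsets is nonempty. -/
def IPP {Q : Type*} {n : ℕ} (C : Set (Fin n → Q)) (w : ℕ) : Prop :=
  ∀ x : Fin n → Q,
    (∃ U : Finset (Fin n → Q), ↑U ⊆ C ∧ U.Nonempty ∧ U.card ≤ w ∧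
      x ∈ descSet (↑U : Set (Fin n → Q))) →
    ∃ a : Fin n → Q, ∀ U : Finset (Fin n → Q), ↑U ⊆ C → U.Nonempty → U.card ≤ w →
      x ∈ descSet (↑U : Set (Fin n → Q)) → a ∈ U

/-- If `x` is a descendant of a nonempty set `U` of at most `w` words, then some word of `U`
agrees with `x` on at least a `1 / w` fraction of any given set `S` of coordinates. -/
theorem exists_mem_card_le_mul_card_agree {Q : Type*} [DecidableEq Q] {n w : ℕ}
    {x : Fin n → Q} {U : Finset (Fin n → Q)} (hU : U.Nonempty) (hUw : U.card ≤ w)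
    (hx : x ∈ descSet (↑U : Set (Fin n → Q))) (S : Finset (Fin n)) :
    ∃ b ∈ U, S.card ≤ w * (S.filter fun i => b i = x i).card := by
  obtain ⟨b, hb, hmax⟩ := U.exists_max_image (fun b => (S.filter fun i => b i = x i).card) hU
  refine ⟨b, hb, ?_⟩
  calc S.card ≤ (U.biUnion fun c => S.filter fun i => c i = x i).card := by
        refine Finset.card_le_card fun i hi => ?_
        obtain ⟨c, hc, hci⟩ := hx i
        exact Finset.mem_biUnion.2 ⟨c, hc, Finset.mem_filter.2 ⟨hi, hci⟩⟩
    _ ≤ U.card * (S.filter fun i => b i = x i).card :=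
        Finset.card_biUnion_le_card_mul _ _ _ hmax
    _ ≤ w * (S.filter fun i => b i = x i).card := Nat.mul_le_mul_right _ hUw

/-- If `a` and `b` agree on all of `T`, then `|T|` plus their Hamming distance is at most the
length. -/
theorem card_add_hammingDist_le {Q : Type*} [DecidableEq Q] {n : ℕ} {a b : Fin n → Q}
    {T : Finset (Fin n)} (hT : ∀ i ∈ T, a i = b i) : T.card + hammingDist a b ≤ n := by
  have hdisj : Disjoint T (Finset.univ.filter fun i => a i ≠ b i) :=
    Finset.disjoint_left.2 fun i hi h => (Finset.mem_filter.1 h).2 (hT i hi)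
  have h := Finset.card_le_univ (T ∪ Finset.univ.filter fun i => a i ≠ b i)
  rwa [Finset.card_union_of_disjoint hdisj, Fintype.card_fin] at h

/-- If a code `C` with at least two codewords has minimum distance `d` with
`d · w² > n · (w² - 1)`, then `C` is a `w`-IPP code. -/
theorem IPP_of_min_dist {Q : Type*} [Fintype Q] [DecidableEq Q] {n : ℕ} (hn : 0 < n)
    {w : ℕ} (hw : 2 ≤ w) (C : Set (Fin n → Q)) (d : ℕ)
    (hmin : ∀ a ∈ C, ∀ b ∈ C, a ≠ b → d ≤ hammingDist a b)
    (hex : ∃ a ∈ C, ∃ b ∈ C, a ≠ b ∧ hammingDist a b = d)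
    (hd : n * (w ^ 2 - 1) < d * w ^ 2) :
    IPP C w := by
  rintro x ⟨U₀, hU₀C, hU₀, hU₀w, hx₀⟩
  obtain ⟨a, ha, hacard⟩ := exists_mem_card_le_mul_card_agree hU₀ hU₀w hx₀ Finset.univ
  refine ⟨a, fun U hUC hU hUw hxU => ?_⟩
  set S := Finset.univ.filter fun i => a i = x i with hS
  obtain ⟨b, hb, hbcard⟩ := exists_mem_card_le_mul_card_agree hU hUw hxU S
  set T := S.filter fun i => b i = x i with hT
  rw [Finset.card_univ, Fintype.card_fin] at hacard
  by_cases hab : a = b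
  · exact hab ▸ hb
  exfalso
  have hdist := hmin a (hU₀C ha) b (hUC hb) hab
  have hagree : T.card + hammingDist a b ≤ n := by
    refine card_add_hammingDist_le fun i hi => ?_
    rw [hT, Finset.mem_filter, hS, Finset.mem_filter] at hi
    exact hi.1.2.trans hi.2.symm
  have hn_le : n ≤ w ^ 2 * T.card := by
    calc n ≤ w * S.card := hacard
      _ ≤ w * (w * T.card) := Nat.mul_le_mul_left _ hbcard
      _ = w ^ 2 * T.card := by ring
  have hle : w ^ 2 * (T.card + d) ≤ w ^ 2 * n := Nat.mul_le_mul_left _ (by omega)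
  rw [Nat.mul_sub, mul_one] at hd
  rw [mul_add] at hle
  rw [mul_comm n, mul_comm d] at hd
  omega
end

section
/- Let w1, w2 be positive integers with at least one of them greater than 1, and let C be a code of length n over a finite alphabet Q with at least two codewords and minimum distance d. If d > n(1 − 1/(w1·w2)), i.e., d·w1·w2 > n·(w1·w2 − 1), then C is a (w1,w2)-separating code. -/
/-- The coordinates where two words agree and those where they differ partition all
coordinates. -/
theorem card_agree_add_hammingDist {Q : Type*} [DecidableEq Q] {n : ℕ} (a b : Fin n → Q) :
    (Finset.univ.filter fun i => a i = b i).card + hammingDist a b = n := by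
  simpa [hammingDist] using
    Finset.card_filter_add_card_filter_not (s := Finset.univ) fun i => a i = b i

/-- If two finite sets of words have a common descendant, and each word of one agrees with
each word of the other in at most `m` coordinates, then the length is at most `m` times the
number of pairs. -/
theorem length_le_of_mem_descSet {Q : Type*} [DecidableEq Q] {n m : ℕ}
    {U V : Finset (Fin n → Q)} {x : Fin n → Q}
    (hU : x ∈ descSet (↑U : Set (Fin n → Q))) (hV : x ∈ descSet (↑V : Set (Fin n → Q)))
    (h : ∀ a ∈ U, ∀ b ∈ V, (Finset.univ.filter fun i => a i = b i).card ≤ m) :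
    n ≤ U.card * V.card * m := by
  have hcover : (Finset.univ : Finset (Fin n)) ⊆
      (U ×ˢ V).biUnion fun p => Finset.univ.filter fun i => p.1 i = p.2 i := by
    intro i _
    obtain ⟨a, ha, hai⟩ := hU i
    obtain ⟨b, hb, hbi⟩ := hV i
    simp only [Finset.mem_biUnion, Finset.mem_product, Finset.mem_filter]
    exact ⟨(a, b), ⟨ha, hb⟩, Finset.mem_univ i, hai.trans hbi.symm⟩
  calc n = (Finset.univ : Finset (Fin n)).card := (Finset.card_fin n).symm
    _ ≤ _ := Finset.card_le_card hcover
    _ ≤ (U ×ˢ V).card * m := Finset.card_biUnion_le_card_mul _ _ _ fun p hp =>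
        h p.1 (Finset.mem_product.1 hp).1 p.2 (Finset.mem_product.1 hp).2
    _ = U.card * V.card * m := by rw [Finset.card_product]

/-- If a code `C` with at least two codewords has minimum distance `d` with
`d · w1 · w2 > n · (w1 · w2 - 1)`, then `C` is `(w1, w2)`-separating. -/
theorem separating_of_min_dist {Q : Type*} [Fintype Q] [DecidableEq Q] {n : ℕ} (hn : 0 < n)
    {w1 w2 : ℕ} (hw1 : 1 ≤ w1) (hw2 : 1 ≤ w2) (hw : 1 < w1 ∨ 1 < w2)
    (C : Set (Fin n → Q)) (d : ℕ)
    (hmin : ∀ a ∈ C, ∀ b ∈ C, a ≠ b → d ≤ hammingDist a b)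
    (hex : ∃ a ∈ C, ∃ b ∈ C, a ≠ b ∧ hammingDist a b = d)
    (hd : n * (w1 * w2 - 1) < d * (w1 * w2)) :
    Separating C w1 w2 := by
  intro U V hUC hVC _ _ hUV hU hV
  rw [Set.disjoint_left]
  intro x hxU hxV
  have hdn : d ≤ n := by
    obtain ⟨a, -, b, -, -, rfl⟩ := hex
    exact (Nat.le_add_left _ _).trans_eq (card_agree_add_hammingDist a b)
  have hagree : ∀ a ∈ U, ∀ b ∈ V, (Finset.univ.filter fun i => a i = b i).card ≤ n - d := by
    intro a ha b hb
    have hdist := hmin a (hUC ha) b (hVC hb) (Finset.disjoint_iff_ne.1 hUV a ha b hb)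
    have hsum := card_agree_add_hammingDist a b
    omega
  have hle : n ≤ w1 * w2 * (n - d) :=
    (length_le_of_mem_descSet hxU hxV hagree).trans (by gcongr)
  have hpos : 1 ≤ w1 * w2 := Nat.mul_pos hw1 hw2
  zify [hdn, hpos] at hle hd
  linarith
end

section
/- Let w ≥ 3 be an integer, let C be a restricted (w,w)-separating code of length n over a finite alphabet Q, and let U ⊆ C with |U| = w−2. Let S be the set of coordinates i on which all words of U coincide, fix x⁽¹⁾ ∈ U, and for each y ∈ C∖U define Γ(y) = {i ∈ S : y_i = x⁽¹⁾_i}. Then for all pairwise distinct y, z, t ∈ C∖U: (1) Γ(y) ∩ Γ(z) ≠ ∅; (2) Γ(y) is not a subset of Γ(z); (3) Γ(y) ∩ Γ(z) ≠ S; (4) Γ(y) ∩ Γ(z) is not a subset of Γ(t); and (5) Γ(t) is not a subset of Γ(y) ∪ Γ(z). -/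
/-- Disjoint subsets of a restricted separating code are separated by a coordinate on which
each of them is constant, with different values. -/
theorem RestrictedSeparating.exists_coord {Q : Type*} {n w1 w2 : ℕ} {C : Set (Fin n → Q)}
    (hC : RestrictedSeparating C w1 w2) {U V : Finset (Fin n → Q)} (hU : ↑U ⊆ C) (hV : ↑V ⊆ C)
    (hUV : Disjoint U V) (hU1 : U.card ≤ w1) (hV2 : V.card ≤ w2)
    {u v : Fin n → Q} (hu : u ∈ U) (hv : v ∈ V) :
    ∃ i, (∀ a ∈ U, a i = u i) ∧ (∀ b ∈ V, b i = v i) ∧ u i ≠ v i := by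
  classical
  by_contra! h
  have hdisj := hC U V hU hV ⟨u, hu⟩ ⟨v, hv⟩ hUV hU1 hV2
  rw [Set.disjoint_left] at hdisj
  refine @hdisj (fun i => if ∀ a ∈ U, a i = u i then u i else v i) ?_ ?_
  · intro i c hc
    have hconst : ∀ a ∈ U, a i = u i := fun a ha => (hc a ha).trans (hc u hu).symm
    exact (if_pos hconst).trans (hc u hu)
  · intro i c hc
    have hconst : ∀ b ∈ V, b i = v i := fun b hb => (hc b hb).trans (hc v hv).symm
    show (if ∀ a ∈ U, a i = u i then u i else v i) = c
    split_ifs with hUi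
    · exact (h i hUi hconst).trans (hc v hv)
    · exact hc v hv

/-- The five combinatorial properties of the sets `Γ(y)` from the proof of Theorem 4:
for a restricted `(w, w)`-separating code `C`, a subset `U ⊆ C` with `w - 2` elements,
`S` the set of coordinates where all words of `U` coincide, `x1 ∈ U`, and
`Γ(y) = {i ∈ S : y_i = x1_i}`, any pairwise distinct `y, z, t ∈ C \ U` satisfy
(1) `Γ(y) ∩ Γ(z) ≠ ∅`, (2) `Γ(y) ⊄ Γ(z)`, (3) `Γ(y) ∩ Γ(z) ≠ S`,
(4) `Γ(y) ∩ Γ(z) ⊄ Γ(t)`, (5) `Γ(t) ⊄ Γ(y) ∪ Γ(z)`. -/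
theorem gamma_properties {Q : Type*} [Fintype Q] {n w : ℕ} (hw : 3 ≤ w) (hn : 0 < n)
    (C : Set (Fin n → Q)) (hC : RestrictedSeparating C w w)
    (U : Finset (Fin n → Q)) (hUC : ↑U ⊆ C) (hUcard : U.card = w - 2)
    (x1 : Fin n → Q) (hx1 : x1 ∈ U)
    (S : Set (Fin n)) (hS : S = {i | ∀ a ∈ U, ∀ b ∈ U, a i = b i})
    (Γ : (Fin n → Q) → Set (Fin n)) (hΓ : ∀ y, Γ y = {i | i ∈ S ∧ y i = x1 i}) :
    ∀ y z t : Fin n → Q, y ∈ C \ ↑U → z ∈ C \ ↑U → t ∈ C \ ↑U →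
      y ≠ z → y ≠ t → z ≠ t →
      (Γ y ∩ Γ z).Nonempty ∧
      ¬ (Γ y ⊆ Γ z) ∧
      Γ y ∩ Γ z ≠ S ∧
      ¬ (Γ y ∩ Γ z ⊆ Γ t) ∧
      ¬ (Γ t ⊆ Γ y ∪ Γ z) := by
  classical
  have mem_S : ∀ i, (∀ a ∈ U, a i = x1 i) → i ∈ S := fun i h => by
    rw [hS]
    exact fun a ha b hb => (h a ha).trans (h b hb).symm
  have mem_Γ : ∀ y i, i ∈ Γ y ↔ i ∈ S ∧ y i = x1 i := fun y i => by rw [hΓ]; rfl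
  have exists_mem_inter : ∀ y z t, y ∈ C \ ↑U → z ∈ C \ ↑U → t ∈ C \ ↑U → y ≠ t → z ≠ t →
      ∃ i, i ∈ Γ y ∧ i ∈ Γ z ∧ i ∉ Γ t := by
    rintro y z t ⟨hyC, -⟩ ⟨hzC, -⟩ ⟨htC, htU⟩ hyt hzt
    have hcard : (insert y (insert z U)).card ≤ w := by
      have := Finset.card_insert_le y (insert z U)
      have := Finset.card_insert_le z U
      omega
    obtain ⟨i, hi, -, hne⟩ := hC.exists_coord (U := insert y (insert z U)) (V := {t})
      (by simp [Set.insert_subset_iff, hyC, hzC, hUC]) (by simpa using htC)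
      (by simpa using ⟨hyt.symm, hzt.symm, htU⟩)
      hcard (by simp; omega) (u := x1) (v := t) (by simp [hx1]) (by simp)
    have hiS : i ∈ S := mem_S i fun a ha => hi a (by simp [ha])
    exact ⟨i, (mem_Γ y i).2 ⟨hiS, hi y (by simp)⟩, (mem_Γ z i).2 ⟨hiS, hi z (by simp)⟩,
      fun ht => hne ((mem_Γ t i).1 ht).2.symm⟩
  intro y z t hy hz ht hyz hyt hzt
  obtain ⟨i, hiy, hiz, hit⟩ := exists_mem_inter y z t hy hz ht hyt hzt
  obtain ⟨j, hjy, -, hjz⟩ := exists_mem_inter y y z hy hy hz hyz hyz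
  refine ⟨⟨i, hiy, hiz⟩, fun h => hjz (h hjy), fun h => ?_, fun h => hit (h ⟨hiy, hiz⟩), fun h => ?_⟩
  · exact hjz (h.ge ((mem_Γ y j).1 hjy).1).2
  · have hcard : (insert t U).card ≤ w := by
      have := Finset.card_insert_le t U
      omega
    obtain ⟨k, hk, hkV, hne⟩ := hC.exists_coord (U := insert t U) (V := {y, z})
      (by simp [Set.insert_subset_iff, ht.1, hUC])
      (by simp [Set.insert_subset_iff, hy.1, hz.1])
      (by simpa using ⟨⟨hyt, hy.2⟩, hzt, hz.2⟩)
      hcard (Finset.card_le_two.trans (by omega)) (u := x1) (v := y) (by simp [hx1]) (by simp)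
    have hkS : k ∈ S := mem_S k fun a ha => hk a (by simp [ha])
    rcases h ((mem_Γ t k).2 ⟨hkS, hk t (by simp)⟩) with hky | hkz
    · exact hne ((mem_Γ y k).1 hky).2.symm
    · exact hne (((mem_Γ z k).1 hkz).2.symm.trans (hkV z (by simp)))
end
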